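/- Let k ≥ 3 and ε ∈ (0,1) be fixed. There is a constant r₀ = r₀(k,ε) such that for any function r = r(n) satisfying r ≥ r₀ and r^{k−1} ln r = o(n^{k−1}), one has P(ch(H(n,k,p)) ≤ r) → 1 as n → ∞, where p = (1−ε) · (r^{k−1} ln r / k) · n/C(n,k). -/

import Mathlib

open Finset Filter

open scoped Classical

namespace HG

/-- A finset `e` is monochromatic under the coloring `c`. -/
def Monochromatic {V α : Type*} (c : V → α) (e : Finset V) : Prop :=
  ∀ v ∈ e, ∀ w ∈ e, c v = c w

/-- The hypergraph with edge set `E` admits a proper coloring with `r` colors. -/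
def RColorable {V : Type*} (r : ℕ) (E : Finset (Finset V)) : Prop :=
  ∃ c : V → Fin r, ∀ e ∈ E, ¬ Monochromatic c e

/-- The hypergraph with edge set `E` is `r`-choosable: for every assignment of
color lists of size `r` there is a proper coloring from the lists. -/
def RChoosable {V : Type*} (r : ℕ) (E : Finset (Finset V)) : Prop :=
  ∀ L : V → Finset ℕ, (∀ v, (L v).card = r) →
    ∃ c : V → ℕ, (∀ v, c v ∈ L v) ∧ ∀ e ∈ E, ¬ Monochromatic c e

/-- Probability that the binomial random hypergraph `H(n,k,p)` (each of the
`C(n,k)` possible `k`-element edges present independently with probability `p`)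
satisfies the property `P` of its edge set. -/
noncomputable def hyperProb (n k : ℕ) (p : ℝ)
    (P : Finset (Finset (Fin n)) → Prop) : ℝ :=
  ∑ E ∈ ((Finset.univ : Finset (Fin n)).powersetCard k).powerset,
    if P E then
      p ^ E.card *
        (1 - p) ^ (((Finset.univ : Finset (Fin n)).powersetCard k).card - E.card)
    else 0

/-- Maximum vertex degree of the hypergraph with edge set `E`. -/
def maxDegree {V : Type*} [DecidableEq V] (E : Finset (Finset V)) : ℕ :=
  (E.biUnion id).sup fun v => (E.filter fun e => v ∈ e).card

/-- Three distinct edges forming a 3-cycle (triangle). -/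
def IsTriangle {V : Type*} [DecidableEq V] (e f h : Finset V) : Prop :=
  e ≠ f ∧ e ≠ h ∧ f ≠ h ∧ ((e ∩ f) \ h).Nonempty ∧ ((e ∩ h) \ f).Nonempty ∧
    ((f ∩ h) \ e).Nonempty

/-- A hypergraph is 2-simple if any two distinct edges share at most 2 vertices. -/
def TwoSimple {V : Type*} [DecidableEq V] (E : Finset (Finset V)) : Prop :=
  ∀ e ∈ E, ∀ f ∈ E, e ≠ f → (e ∩ f).card ≤ 2

/-- The number of 3-cycles of the hypergraph `E` containing the edge `e`. -/
noncomputable def triCount {V : Type*} [DecidableEq V]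
    (E : Finset (Finset V)) (e : Finset V) : ℕ :=
  ((E.powersetCard 2).filter fun s =>
    ∃ f ∈ s, ∃ h ∈ s, f ≠ h ∧ IsTriangle e f h).card

/-- The function `φ(k) = 4⌊√(ln k / ln (2 ln k))⌋⁻¹`. -/
noncomputable def phi (k : ℕ) : ℝ :=
  4 * ((⌊Real.sqrt (Real.log k / Real.log (2 * Real.log k))⌋₊ : ℝ))⁻¹

/-- Probability that a random subset of `Ω`, containing each element independently with
probability `p`, has the property `P`. -/
noncomputable def bernProb {α : Type*} (Ω : Finset α) (p : ℝ) (P : Finset α → Prop) : ℝ :=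
  ∑ E ∈ Ω.powerset, if P E then p ^ E.card * (1 - p) ^ (Ω.card - E.card) else 0

section Probability

variable {α ι : Type*} {Ω : Finset α} {p : ℝ}

lemma bernProb_true (Ω : Finset α) (p : ℝ) : bernProb Ω p (fun _ => True) = 1 := by
  simp [bernProb, Finset.sum_pow_mul_eq_add_pow]

lemma bernProb_le_sum (h0 : 0 ≤ p) (h1 : p ≤ 1) {P : Finset α → Prop} (I : Finset ι)
    {Q : ι → Finset α → Prop} (h : ∀ E ⊆ Ω, P E → ∃ i ∈ I, Q i E) :
    bernProb Ω p P ≤ ∑ i ∈ I, bernProb Ω p (Q i) := by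
  have h1' : 0 ≤ 1 - p := by linarith
  unfold bernProb
  rw [Finset.sum_comm]
  refine Finset.sum_le_sum fun E hE => ?_
  have hw : 0 ≤ p ^ E.card * (1 - p) ^ (Ω.card - E.card) := by positivity
  have hnn : ∀ i ∈ I, 0 ≤ if Q i E then p ^ E.card * (1 - p) ^ (Ω.card - E.card) else 0 := by
    intro i _
    split_ifs <;> simp [hw]
  split_ifs with hP
  · obtain ⟨i, hi, hQ⟩ := h E (Finset.mem_powerset.1 hE) hP
    refine le_trans ?_ (Finset.single_le_sum hnn hi)
    simp [hQ]
  · exact Finset.sum_nonneg hnn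

lemma bernProb_mono (h0 : 0 ≤ p) (h1 : p ≤ 1) {P Q : Finset α → Prop}
    (h : ∀ E ⊆ Ω, P E → Q E) : bernProb Ω p P ≤ bernProb Ω p Q := by
  have := bernProb_le_sum (Ω := Ω) h0 h1 (P := P) ({()} : Finset Unit) (Q := fun _ => Q)
    (fun E hE hP => ⟨(), by simp, h E hE hP⟩)
  simpa using this

lemma bernProb_le_one (h0 : 0 ≤ p) (h1 : p ≤ 1) (P : Finset α → Prop) :
    bernProb Ω p P ≤ 1 :=
  (bernProb_mono h0 h1 (Q := fun _ => True) (by simp)).trans_eq (bernProb_true Ω p)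

lemma bernProb_inter_mul_sdiff {A : Finset α} (hA : A ⊆ Ω) (P Q : Finset α → Prop) :
    bernProb Ω p (fun E => P (E ∩ A) ∧ Q (E \ A)) =
      bernProb A p P * bernProb (Ω \ A) p Q := by
  unfold bernProb
  rw [Finset.sum_mul_sum, ← Finset.sum_product']
  refine Finset.sum_nbij' (fun E => (E ∩ A, E \ A)) (fun X => X.1 ∪ X.2) ?_ ?_ ?_ ?_ ?_
  · intro E hE
    simp only [Finset.mem_powerset, Finset.mem_product] at hE ⊢
    exact ⟨Finset.inter_subset_right, Finset.sdiff_subset_sdiff hE le_rfl⟩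
  · intro X hX
    simp only [Finset.mem_powerset, Finset.mem_product] at hX ⊢
    exact Finset.union_subset (hX.1.trans hA) (hX.2.trans Finset.sdiff_subset)
  · intro E _
    ext a
    simp only [Finset.mem_union, Finset.mem_inter, Finset.mem_sdiff]
    tauto
  · rintro ⟨X, Y⟩ hX
    simp only [Finset.mem_powerset, Finset.mem_product] at hX
    have hY : ∀ a ∈ Y, a ∉ A := fun a ha => (Finset.mem_sdiff.1 (hX.2 ha)).2
    have hXA : ∀ a ∈ X, a ∈ A := fun a ha => hX.1 ha
    refine Prod.ext ?_ ?_ <;> ext a <;>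
      simp only [Finset.mem_union, Finset.mem_inter, Finset.mem_sdiff] <;>
      specialize hY a <;> specialize hXA a <;> tauto
  · intro E hE
    simp only [Finset.mem_powerset] at hE
    have h1 : (E ∩ A).card + (E \ A).card = E.card := Finset.card_inter_add_card_sdiff E A
    have h2 : (Ω \ A).card + A.card = Ω.card := Finset.card_sdiff_add_card_eq_card hA
    have h3 : (E ∩ A).card ≤ A.card := Finset.card_le_card Finset.inter_subset_right
    have h4 : (E \ A).card ≤ (Ω \ A).card :=
      Finset.card_le_card (Finset.sdiff_subset_sdiff hE le_rfl)
    have h5 : Ω.card - E.card = (A.card - (E ∩ A).card) + ((Ω \ A).card - (E \ A).card) := by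
      omega
    by_cases hP : P (E ∩ A) <;> by_cases hQ : Q (E \ A) <;> simp only [hP, hQ, and_true, and_false,
      if_true, if_false, mul_zero, zero_mul]
    rw [h5, ← h1, pow_add, pow_add]
    ring

lemma bernProb_nonempty (A : Finset α) (p : ℝ) :
    bernProb A p (fun E => E.Nonempty) = 1 - (1 - p) ^ A.card := by
  have h := bernProb_true A p
  unfold bernProb at h ⊢
  rw [← Finset.add_sum_erase _ _ (Finset.empty_mem_powerset A)] at h ⊢
  simp only [Finset.not_nonempty_empty, if_false, if_true, Finset.card_empty, pow_zero, one_mul,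
    tsub_zero, zero_add] at h ⊢
  refine Eq.trans ?_ (sub_eq_of_eq_add' h.symm).symm
  refine Finset.sum_congr rfl fun E hE => ?_
  rw [if_pos (Finset.nonempty_iff_ne_empty.2 (Finset.mem_erase.1 hE).1)]

/-- Independence of the events that a random set meets each of a family of disjoint sets. -/
lemma bernProb_forall_exists_mem (I : Finset ι) (F : ι → Finset α) :
    ∀ Ω : Finset α, (∀ i ∈ I, F i ⊆ Ω) →
      (∀ i ∈ I, ∀ j ∈ I, i ≠ j → Disjoint (F i) (F j)) →
      bernProb Ω p (fun E => ∀ i ∈ I, ∃ e ∈ F i, e ∈ E) =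
        ∏ i ∈ I, (1 - (1 - p) ^ (F i).card) := by
  induction I using Finset.induction_on with
  | empty => intro Ω _ _; simpa using bernProb_true Ω p
  | insert i I hi ih =>
    intro Ω hF hd
    have hd' : ∀ j ∈ I, Disjoint (F i) (F j) := fun j hj =>
      hd i (by simp) j (by simp [hj]) (by rintro rfl; exact hi hj)
    rw [Finset.prod_insert hi, ← bernProb_nonempty, ← ih (Ω \ F i)
      (fun j hj => Finset.subset_sdiff.2 ⟨hF j (by simp [hj]), (hd' j hj).symm⟩)
      (fun a ha b hb => hd a (by simp [ha]) b (by simp [hb])),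
      ← bernProb_inter_mul_sdiff (hF i (by simp))]
    congr 1
    funext E
    simp only [Finset.forall_mem_insert, eq_iff_iff]
    refine and_congr ?_ (forall₂_congr fun j hj => ?_)
    · simp [Finset.Nonempty, and_comm]
    · refine exists_congr fun e => and_congr_right fun he => ?_
      have : e ∉ F i := fun h => Finset.disjoint_left.1 (hd' j hj) h he
      simp [this]

lemma choose_le_three_mul_div_pow (N m : ℕ) :
    (N.choose m : ℝ) ≤ (3 * N / m) ^ m := by
  rcases Nat.eq_zero_or_pos m with rfl | hm
  · simp
  have hm' : (0 : ℝ) < m := by exact_mod_cast hm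
  have h1 : (N.choose m : ℝ) ≤ (N : ℝ) ^ m / m.factorial := Nat.choose_le_pow_div m N
  have h2 : (m : ℝ) ^ m / m.factorial ≤ Real.exp m := Real.pow_div_factorial_le_exp m hm'.le m
  have h3 : Real.exp m ≤ 3 ^ m := by
    rw [← Real.exp_one_pow]
    have := Real.exp_one_lt_d9
    gcongr
    linarith
  have h4 : (0 : ℝ) < m.factorial := by exact_mod_cast m.factorial_pos
  calc (N.choose m : ℝ) ≤ (N : ℝ) ^ m / m.factorial := h1
    _ = ((N : ℝ) / m) ^ m * ((m : ℝ) ^ m / m.factorial) := by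
      rw [div_pow]; field_simp
    _ ≤ ((N : ℝ) / m) ^ m * 3 ^ m := by gcongr; exact h2.trans h3
    _ = (3 * N / m) ^ m := by rw [← mul_pow]; congr 1; ring

/-- Upper tail estimate for the number of elements of `F` in a random set. -/
lemma bernProb_le_card_inter (h0 : 0 ≤ p) (h1 : p ≤ 1) {F : Finset α} (hF : F ⊆ Ω) (m : ℕ) :
    bernProb Ω p (fun E => m ≤ (E ∩ F).card) ≤ (3 * F.card / m * p) ^ m := by
  have key : ∀ A ∈ F.powersetCard m,
      bernProb Ω p (fun E => ∀ e ∈ A, ∃ a ∈ ({e} : Finset α), a ∈ E) = p ^ m := by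
    intro A hA
    rw [Finset.mem_powersetCard] at hA
    rw [bernProb_forall_exists_mem A (fun e => {e}) Ω
      (fun i hi => by simpa using hF (hA.1 hi)) (by simp)]
    simp [hA.2]
  refine (bernProb_le_sum h0 h1 (F.powersetCard m)
    (Q := fun A E => ∀ e ∈ A, ∃ a ∈ ({e} : Finset α), a ∈ E) ?_).trans ?_
  · intro E _ hm
    obtain ⟨A, hA, hc⟩ := Finset.exists_subset_card_eq hm
    exact ⟨A, Finset.mem_powersetCard.2 ⟨hA.trans Finset.inter_subset_right, hc⟩,
      fun e he => ⟨e, by simp, (Finset.mem_inter.1 (hA he)).1⟩⟩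
  · rw [Finset.sum_congr rfl key, Finset.sum_const, Finset.card_powersetCard, nsmul_eq_mul, mul_pow]
    gcongr
    exact choose_le_three_mul_div_pow _ _

end Probability

section Deterministic

variable {V : Type*} [Fintype V] [DecidableEq V]

/-- The colorings of `S` from the lists `L` without monochromatic edges inside `S`, extended
by the color `0` outside `S`. -/
noncomputable def listColorings (E : Finset (Finset V)) (L : V → Finset ℕ) (S : Finset V) :
    Finset (V → ℕ) :=
  (Fintype.piFinset fun v => if v ∈ S then L v else {0}).filter fun c =>
    ∀ e ∈ E, e ⊆ S → ¬ Monochromatic c e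

lemma mem_listColorings {E : Finset (Finset V)} {L : V → Finset ℕ} {S : Finset V} {c : V → ℕ} :
    c ∈ listColorings E L S ↔ (∀ v ∈ S, c v ∈ L v) ∧ (∀ v ∉ S, c v = 0) ∧
      ∀ e ∈ E, e ⊆ S → ¬ Monochromatic c e := by
  simp only [listColorings, Finset.mem_filter, Fintype.mem_piFinset, ← and_assoc]
  refine and_congr_left fun _ => ⟨fun h => ⟨fun v hv => ?_, fun v hv => ?_⟩, fun h v => ?_⟩
  · simpa [hv] using h v
  · simpa [hv] using h v
  · by_cases hv : v ∈ S
    · simpa [hv] using h.1 v hv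
    · simpa [hv] using h.2 v hv

lemma pow_mul_card_listColorings_le {E : Finset (Finset V)} {L : V → Finset ℕ} {h : ℕ}
    {S : Finset V} (R : Finset V) (hRS : R ⊆ S)
    (ih : ∀ T : Finset V, T ⊂ S → ∀ v ∈ S, v ∉ T →
      h * (listColorings E L T).card ≤ (listColorings E L (insert v T)).card) :
    h ^ R.card * (listColorings E L (S \ R)).card ≤ (listColorings E L S).card := by
  induction R using Finset.induction_on with
  | empty => simp
  | insert a R ha ihR =>
    have haS : a ∈ S := hRS (by simp)
    have hR : R ⊆ S := fun x hx => hRS (by simp [hx])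
    refine le_trans ?_ (ihR hR)
    have h1 := ih (S \ insert a R)
      (Finset.sdiff_ssubset hRS ⟨a, by simp⟩) a haS (by simp)
    have h2 : insert a (S \ insert a R) = S \ R := by
      ext x
      simp only [Finset.mem_insert, Finset.mem_sdiff]
      by_cases hx : x = a
      · subst hx; simp [haS, ha]
      · simp [hx]
    rw [h2] at h1
    rw [Finset.card_insert_of_notMem ha, pow_succ, mul_assoc]
    gcongr

/-- The number of list colorings in which the rest of an edge at `v` is monochromatic. -/
lemma card_filter_forall_eq_le {E : Finset (Finset V)} {L : V → Finset ℕ} {S e : Finset V}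
    (q : ℕ) :
    ((listColorings E L S).filter fun c => ∀ w ∈ e ∩ S, c w = q).card ≤
      (listColorings E L (S \ e)).card := by
  refine Finset.card_le_card_of_injOn (fun c w => if w ∈ e then 0 else c w) ?_ ?_
  · intro c hc
    simp only [Finset.coe_filter, Set.mem_ofPred_eq, mem_listColorings] at hc
    simp only [Finset.mem_coe, mem_listColorings, Finset.mem_sdiff]
    refine ⟨fun v hv => by simpa [hv.2] using hc.1.1 v hv.1, fun v hv => ?_, ?_⟩
    · by_cases hve : v ∈ e
      · simp [hve]
      · simpa [hve] using hc.1.2.1 v (fun h => hv ⟨h, hve⟩)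
    · intro f hf hfS hmono
      refine hc.1.2.2 f hf (hfS.trans Finset.sdiff_subset) fun a ha b hb => ?_
      have := hmono a ha b hb
      simpa [(Finset.mem_sdiff.1 (hfS ha)).2, (Finset.mem_sdiff.1 (hfS hb)).2] using this
  · intro c hc d hd hcd
    simp only [Finset.coe_filter, Set.mem_ofPred_eq, mem_listColorings] at hc hd
    funext w
    have hw := congrFun hcd w
    by_cases hwe : w ∈ e
    · by_cases hwS : w ∈ S
      · rw [hc.2 w (by simp [hwe, hwS]), hd.2 w (by simp [hwe, hwS])]
      · rw [hc.1.2.1 w hwS, hd.1.2.1 w hwS]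
    · simpa [hwe] using hw

lemma mul_card_listColorings_le {E : Finset (Finset V)} {k : ℕ} (hE : ∀ e ∈ E, e.card = k)
    {W : Finset V} {L : V → Finset ℕ} {h M : ℕ} (hh : 0 < h)
    (hL : ∀ v ∈ W, (L v).card = 2 * h)
    (hdeg : ∀ v ∈ W, ∀ q ∈ L v,
      (E.filter fun e => v ∈ e ∧ ∀ w ∈ e, w ∈ W ∧ q ∈ L w).card ≤ M)
    (hM : 2 * M ≤ h ^ (k - 1)) (S : Finset V) :
    S ⊆ W → ∀ v ∈ W, v ∉ S →
      h * (listColorings E L S).card ≤ (listColorings E L (insert v S)).card := by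
  induction S using Finset.strongInduction with
  | H S ih =>
  intro hSW v hvW hvS
  set Ed : ℕ → Finset (Finset V) := fun q =>
    E.filter fun e => v ∈ e ∧ ∀ w ∈ e, w ∈ insert v S ∧ q ∈ L w with hEd
  set bad := (L v).biUnion fun q => (Ed q).biUnion fun e =>
    ((listColorings E L S).filter fun c => ∀ w ∈ e ∩ S, c w = q).image fun c => (c, q) with hbad
  have hpairs : (listColorings E L S ×ˢ L v).card ≤
      (listColorings E L (insert v S)).card + bad.card := by
    have : listColorings E L S ×ˢ L v ⊆ ((listColorings E L S ×ˢ L v) \ bad) ∪ bad := by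
      intro x hx
      by_cases hxb : x ∈ bad <;> simp_all
    refine (Finset.card_le_card this).trans ((Finset.card_union_le _ _).trans ?_)
    gcongr
    refine Finset.card_le_card_of_injOn (fun x => Function.update x.1 v x.2) ?_ ?_
    · rintro ⟨c, q⟩ hx
      simp only [Finset.mem_coe, Finset.mem_sdiff, Finset.mem_product, mem_listColorings] at hx
      obtain ⟨⟨⟨hc1, hc2, hc3⟩, hq⟩, hnb⟩ := hx
      simp only [Finset.mem_coe, mem_listColorings]
      refine ⟨fun w hw => ?_, fun w hw => ?_, fun e he heS hmono => ?_⟩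
      · by_cases hwv : w = v
        · subst hwv; simpa using hq
        · simpa [hwv] using hc1 w (Finset.mem_of_mem_insert_of_ne hw hwv)
      · rw [Finset.mem_insert, not_or] at hw
        simpa [hw.1] using hc2 w hw.2
      · by_cases hve : v ∈ e
        · have hcol : ∀ w ∈ e ∩ S, c w = q := by
            intro w hw
            rw [Finset.mem_inter] at hw
            have hwv : w ≠ v := by rintro rfl; exact hvS hw.2
            simpa [hwv] using hmono w hw.1 v hve
          apply hnb
          rw [hbad]
          simp only [Finset.mem_biUnion, Finset.mem_image, Finset.mem_filter, mem_listColorings]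
          refine ⟨q, hq, e, ?_, c, ⟨⟨hc1, hc2, hc3⟩, hcol⟩, rfl⟩
          rw [hEd]
          simp only [Finset.mem_filter]
          refine ⟨he, hve, fun w hw => ⟨heS hw, ?_⟩⟩
          by_cases hwv : w = v
          · subst hwv; exact hq
          · have hwS := Finset.mem_of_mem_insert_of_ne (heS hw) hwv
            rw [← hcol w (by simp [hw, hwS])]
            exact hc1 w hwS
        · refine hc3 e he (fun w hw => Finset.mem_of_mem_insert_of_ne (heS hw)
            (by rintro rfl; exact hve hw)) fun a ha b hb => ?_
          have hav : a ≠ v := by rintro rfl; exact hve ha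
          have hbv : b ≠ v := by rintro rfl; exact hve hb
          simpa [hav, hbv] using hmono a ha b hb
    · rintro ⟨c, q⟩ hx ⟨d, q'⟩ hy hxy
      simp only [Finset.mem_coe, Finset.mem_sdiff, Finset.mem_product, mem_listColorings] at hx hy
      simp only at hxy
      have hq : q = q' := by simpa using congrFun hxy v
      refine Prod.ext ?_ hq
      funext w
      by_cases hwv : w = v
      · subst hwv
        exact (hx.1.1.2.1 w hvS).trans (hy.1.1.2.1 w hvS).symm
      · simpa [hwv] using congrFun hxy w
  have hterm : ∀ q ∈ L v, ∀ e ∈ Ed q, h ^ (k - 1) *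
      (((listColorings E L S).filter fun c => ∀ w ∈ e ∩ S, c w = q).image fun c => (c, q)).card ≤
        (listColorings E L S).card := by
    intro q _ e he
    rw [hEd] at he
    simp only [Finset.mem_filter] at he
    have hcard : (e ∩ S).card = k - 1 := by
      have : e ∩ S = e.erase v := by
        ext w
        simp only [Finset.mem_inter, Finset.mem_erase]
        refine ⟨fun hw => ⟨by rintro rfl; exact hvS hw.2, hw.1⟩, fun hw => ⟨hw.2, ?_⟩⟩
        exact Finset.mem_of_mem_insert_of_ne (he.2.2 w hw.2).1 hw.1
      rw [this, Finset.card_erase_of_mem he.2.1, hE e he.1]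
    have h1 := pow_mul_card_listColorings_le (E := E) (L := L) (h := h) (S := S) (e ∩ S)
      Finset.inter_subset_right
      (fun T hT w hw hwT => ih T hT (hT.1.trans hSW) w (hSW hw) hwT)
    have h2 : S \ (e ∩ S) = S \ e := by
      ext w; simp only [Finset.mem_sdiff, Finset.mem_inter]; tauto
    rw [hcard, h2] at h1
    refine le_trans ?_ h1
    gcongr
    exact Finset.card_image_le.trans (card_filter_forall_eq_le q)
  have hbadle : h ^ (k - 1) * bad.card ≤ 2 * h * (M * (listColorings E L S).card) := by
    calc h ^ (k - 1) * bad.card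
        ≤ h ^ (k - 1) * ∑ q ∈ L v, ∑ e ∈ Ed q, (((listColorings E L S).filter fun c =>
            ∀ w ∈ e ∩ S, c w = q).image fun c => (c, q)).card := by
          gcongr
          refine Finset.card_biUnion_le.trans (Finset.sum_le_sum fun q _ => ?_)
          exact Finset.card_biUnion_le
      _ ≤ ∑ q ∈ L v, ∑ e ∈ Ed q, (listColorings E L S).card := by
          rw [Finset.mul_sum]
          refine Finset.sum_le_sum fun q hq => ?_
          rw [Finset.mul_sum]
          exact Finset.sum_le_sum fun e he => hterm q hq e he
      _ ≤ ∑ q ∈ L v, M * (listColorings E L S).card := by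
          refine Finset.sum_le_sum fun q hq => ?_
          rw [Finset.sum_const, smul_eq_mul]
          gcongr
          refine le_trans (Finset.card_le_card fun e he => ?_) (hdeg v hvW q hq)
          rw [hEd] at he
          simp only [Finset.mem_filter] at he ⊢
          refine ⟨he.1, he.2.1, fun w hw => ⟨?_, (he.2.2 w hw).2⟩⟩
          exact Finset.insert_subset hvW hSW (he.2.2 w hw).1
      _ = 2 * h * (M * (listColorings E L S).card) := by
          rw [Finset.sum_const, smul_eq_mul, hL v hvW]
  have hpos : 0 < h ^ (k - 1) := by positivity
  have hbad' : bad.card ≤ h * (listColorings E L S).card := by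
    refine Nat.le_of_mul_le_mul_left (hbadle.trans ?_) hpos
    calc 2 * h * (M * (listColorings E L S).card)
        = (2 * M) * (h * (listColorings E L S).card) := by ring
      _ ≤ _ := by gcongr
  rw [Finset.card_product, hL v hvW] at hpairs
  nlinarith

/-- A counting version of the local lemma for list colorings of uniform hypergraphs. -/
theorem exists_coloring_of_colorDegree_le {E : Finset (Finset V)} {k : ℕ}
    (hE : ∀ e ∈ E, e.card = k) (hk : 0 < k)
    {W : Finset V} {L : V → Finset ℕ} {h M : ℕ} (hh : 0 < h)
    (hL : ∀ v ∈ W, (L v).card = 2 * h)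
    (hdeg : ∀ v ∈ W, ∀ q ∈ L v,
      (E.filter fun e => v ∈ e ∧ ∀ w ∈ e, w ∈ W ∧ q ∈ L w).card ≤ M)
    (hM : 2 * M ≤ h ^ (k - 1)) :
    ∃ c : V → ℕ, (∀ v ∈ W, c v ∈ L v) ∧ ∀ e ∈ E, e ⊆ W → ¬ Monochromatic c e := by
  have h0 : 0 < (listColorings E L ∅).card := by
    refine Finset.card_pos.2 ⟨fun _ => 0, mem_listColorings.2 ⟨by simp, by simp, ?_⟩⟩
    intro e he he0
    have := hE e he
    rw [Finset.subset_empty.1 he0, Finset.card_empty] at this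
    omega
  have h1 := pow_mul_card_listColorings_le (E := E) (L := L) (h := h) (S := W) W le_rfl
    (fun T hT v hv hvT => mul_card_listColorings_le hE hh hL hdeg hM T hT.1 v hv hvT)
  rw [sdiff_self, Finset.bot_eq_empty] at h1
  have h2 : 0 < (listColorings E L W).card := lt_of_lt_of_le (by positivity) h1
  obtain ⟨c, hc⟩ := Finset.card_pos.1 h2
  rw [mem_listColorings] at hc
  exact ⟨c, hc.1, hc.2.2⟩

lemma sum_card_filter_mem_le {V : Type*} [DecidableEq V] {E : Finset (Finset V)} {k : ℕ}
    (hE : ∀ e ∈ E, e.card = k)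
    (T : Finset V) (P : Finset V → Prop) [DecidablePred P] :
    ∑ v ∈ T, (E.filter fun e => v ∈ e ∧ P e).card ≤
      k * (E.filter fun e => P e ∧ (e ∩ T).Nonempty).card := by
  have h1 : ∀ v ∈ T, (E.filter fun e => v ∈ e ∧ P e).card =
      ∑ e ∈ E.filter (fun e => P e ∧ (e ∩ T).Nonempty), if v ∈ e then 1 else 0 := by
    intro v hv
    rw [← Finset.card_filter, Finset.filter_filter]
    congr 1
    refine Finset.filter_congr fun e _ => ⟨fun h => ⟨⟨h.2, v, by simp [h.1, hv]⟩, h.1⟩,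
      fun h => ⟨h.2, h.1.1⟩⟩
  rw [Finset.sum_congr rfl h1, Finset.sum_comm, mul_comm, ← smul_eq_mul]
  refine Finset.sum_le_card_nsmul _ _ _ fun e he => ?_
  rw [← Finset.card_filter, ← hE e (Finset.mem_filter.1 he).1]
  exact Finset.card_le_card fun v hv => (Finset.mem_filter.1 hv).2

/-- Greedy coloring of a set of vertices all of whose subsets meet few edges twice. -/
lemma exists_coloring_of_sparse {V : Type*} [DecidableEq V] {E : Finset (Finset V)} {k y : ℕ}
    (hE : ∀ e ∈ E, e.card = k)
    {L : V → Finset ℕ} (S : Finset V) (hL : ∀ v ∈ S, k * k * y < (L v).card)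
    (hS : ∀ T ⊆ S, (E.filter fun e => 2 ≤ (e ∩ T).card).card ≤ y * T.card) :
    ∃ c : V → ℕ, (∀ v ∈ S, c v ∈ L v) ∧
      ∀ e ∈ E, 2 ≤ (e ∩ S).card → ∃ a ∈ e ∩ S, ∃ b ∈ e ∩ S, c a ≠ c b := by
  induction S using Finset.strongInduction with
  | H S ih =>
  rcases S.eq_empty_or_nonempty with rfl | hne
  · exact ⟨fun _ => 0, by simp, by simp⟩
  obtain ⟨v, hv, hdeg⟩ : ∃ v ∈ S,
      (E.filter fun e => v ∈ e ∧ 2 ≤ (e ∩ S).card).card ≤ k * y := by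
    refine Finset.exists_le_of_sum_le hne ?_
    rw [Finset.sum_const, smul_eq_mul]
    refine (sum_card_filter_mem_le hE S fun e => 2 ≤ (e ∩ S).card).trans ?_
    have h1 : (E.filter fun e => 2 ≤ (e ∩ S).card ∧ (e ∩ S).Nonempty).card ≤ y * S.card := by
      refine (Finset.card_le_card fun e he => ?_).trans (hS S le_rfl)
      rw [Finset.mem_filter] at he ⊢
      exact ⟨he.1, he.2.1⟩
    refine (Nat.mul_le_mul_left k h1).trans (le_of_eq ?_)
    ring
  obtain ⟨c, hc, hce⟩ := ih (S.erase v) (Finset.erase_ssubset hv)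
    (fun w hw => hL w (Finset.mem_of_mem_erase hw))
    (fun T hT => hS T (hT.trans (Finset.erase_subset _ _)))
  set X := ((E.filter fun e => v ∈ e ∧ 2 ≤ (e ∩ S).card).biUnion id).image c with hX
  have hXc : X.card < (L v).card := by
    refine lt_of_le_of_lt (Finset.card_image_le.trans (Finset.card_biUnion_le_card_mul _ _ k ?_))
      (lt_of_le_of_lt ?_ (hL v hv))
    · intro e he
      exact (hE e (Finset.mem_filter.1 he).1).le
    · calc _ ≤ k * y * k := by gcongr
        _ = _ := by ring
  obtain ⟨q, hq, hqX⟩ := Finset.exists_mem_notMem_of_card_lt_card hXc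
  refine ⟨Function.update c v q, fun w hw => ?_, fun e he h2 => ?_⟩
  · by_cases hwv : w = v
    · subst hwv; simpa using hq
    · simpa [hwv] using hc w (Finset.mem_erase.2 ⟨hwv, hw⟩)
  · by_cases hve : v ∈ e
    · obtain ⟨b, hb, hbv⟩ := Finset.exists_mem_ne (by omega : 1 < (e ∩ S).card) v
      refine ⟨v, by simp [hve, hv], b, hb, ?_⟩
      simp only [Function.update_self, ne_eq, hbv, not_false_eq_true, Function.update_of_ne]
      rintro rfl
      refine hqX (Finset.mem_image_of_mem c (Finset.mem_biUnion.2 ⟨e, ?_, ?_⟩))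
      · simp [he, hve, h2]
      · exact (Finset.mem_inter.1 hb).1
    · have h3 : e ∩ S.erase v = e ∩ S := by
        ext w
        simp only [Finset.mem_inter, Finset.mem_erase]
        exact ⟨fun h => ⟨h.1, h.2.2⟩, fun h => ⟨h.1, by rintro rfl; exact hve h.1, h.2⟩⟩
      have := hce e he (by rwa [h3])
      rw [h3] at this
      obtain ⟨a, ha, b, hb, hab⟩ := this
      have hav : a ≠ v := by rintro rfl; exact hve (Finset.mem_inter.1 ha).1
      have hbv : b ≠ v := by rintro rfl; exact hve (Finset.mem_inter.1 hb).1
      exact ⟨a, ha, b, hb, by simpa [hav, hbv] using hab⟩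

/-- A set of vertices can be enlarged to one such that no outside vertex has many edges to it. -/
lemma exists_closure {V : Type*} [DecidableEq V] {E : Finset (Finset V)} {k y : ℕ}
    (hE : ∀ e ∈ E, e.card = k)
    (W B : Finset V) (hBW : B ⊆ W)
    (hC : ∀ T : Finset V, T.card ≤ 2 * B.card →
      (E.filter fun e => 2 ≤ (e ∩ T).card).card ≤ y * T.card) :
    ∃ S, B ⊆ S ∧ S ⊆ W ∧ S.card ≤ 2 * B.card ∧ ∀ v ∈ W, v ∉ S →
      (E.filter fun e => v ∈ e ∧ (e ∩ S).Nonempty).card ≤ 2 * k * y := by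
  rcases B.eq_empty_or_nonempty with rfl | hne
  · exact ⟨∅, by simp⟩
  set Φ : Finset V → ℕ := fun S => ∑ e ∈ E, ((e ∩ S).card - 1) with hΦ
  set 𝒮 := W.powerset.filter fun S => B ⊆ S ∧ S.card ≤ 2 * B.card ∧
    (2 * k * y + 1) * (S.card - B.card) ≤ Φ S with h𝒮
  have hB𝒮 : B ∈ 𝒮 := by
    simp only [h𝒮, Finset.mem_filter, Finset.mem_powerset]
    refine ⟨hBW, le_rfl, by omega, by simp⟩
  obtain ⟨S, hS, hmax⟩ := Finset.exists_max_image 𝒮 Finset.card ⟨B, hB𝒮⟩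
  simp only [h𝒮, Finset.mem_filter, Finset.mem_powerset] at hS
  obtain ⟨hSW, hBS, hScard, hSΦ⟩ := hS
  refine ⟨S, hBS, hSW, hScard, fun v hvW hvS => ?_⟩
  by_contra! hlt
  have hle : B.card ≤ S.card := Finset.card_le_card hBS
  have hΦle : Φ S ≤ k * (y * S.card) := by
    calc Φ S = ∑ e ∈ E.filter (fun e => 2 ≤ (e ∩ S).card), ((e ∩ S).card - 1) := by
          rw [hΦ, Finset.sum_filter]
          refine Finset.sum_congr rfl fun e _ => ?_
          split_ifs <;> omega
      _ ≤ ∑ e ∈ E.filter (fun e => 2 ≤ (e ∩ S).card), k := by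
          refine Finset.sum_le_sum fun e he => ?_
          have := hE e (Finset.mem_filter.1 he).1
          have h2 : (e ∩ S).card ≤ e.card := Finset.card_le_card Finset.inter_subset_left
          omega
      _ = k * (E.filter fun e => 2 ≤ (e ∩ S).card).card := by
          rw [Finset.sum_const, smul_eq_mul, mul_comm]
      _ ≤ _ := by gcongr; exact hC S hScard
  have hBpos := hne.card_pos
  have hS2 : S.card < 2 * B.card := by
    refine lt_of_le_of_ne hScard fun heq => ?_
    rw [heq] at hSΦ hΦle
    have h3 : 2 * B.card - B.card = B.card := by omega
    rw [h3] at hSΦ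
    nlinarith
  have hΦv : Φ S + (2 * k * y + 1) ≤ Φ (insert v S) := by
    calc Φ S + (2 * k * y + 1)
        ≤ Φ S + (E.filter fun e => v ∈ e ∧ (e ∩ S).Nonempty).card := by gcongr; omega
      _ = ∑ e ∈ E, (((e ∩ S).card - 1) + if v ∈ e ∧ (e ∩ S).Nonempty then 1 else 0) := by
          rw [Finset.sum_add_distrib, Finset.card_filter]
      _ ≤ Φ (insert v S) := by
          refine Finset.sum_le_sum fun e _ => ?_
          by_cases hve : v ∈ e
          · rw [Finset.inter_insert_of_mem hve, Finset.card_insert_of_notMem (by simp [hvS])]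
            by_cases hn : (e ∩ S).Nonempty
            · have := hn.card_pos
              simp only [hve, hn, and_self, if_true]
              omega
            · simp [hn]
          · simp [hve, Finset.inter_insert_of_notMem hve]
  have hcard : (insert v S).card = S.card + 1 := Finset.card_insert_of_notMem hvS
  have := hmax (insert v S) (by
    simp only [h𝒮, Finset.mem_filter, Finset.mem_powerset]
    refine ⟨Finset.insert_subset hvW hSW, hBS.trans (Finset.subset_insert _ _), by omega, ?_⟩
    refine le_trans ?_ hΦv
    have h4 : (insert v S).card - B.card = (S.card - B.card) + 1 := by omega
    rw [h4]
    linarith)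
  omega

/-- Coloring by independent sets of size `s` until every unused color is available at fewer
than `u` uncolored vertices. -/
lemma exists_partial_coloring {E : Finset (Finset V)} {s u : ℕ}
    (hE : ∀ e ∈ E, e.Nonempty) (hs : 0 < s) (L : V → Finset ℕ)
    (hA : ∀ U : Finset V, u ≤ U.card → ∃ I ⊆ U, I.card = s ∧ ∀ e ∈ E, ¬ e ⊆ I) :
    ∃ (W : Finset V) (Q : Finset ℕ) (c : V → ℕ), s * Q.card + W.card = Fintype.card V ∧
      (∀ v ∉ W, c v ∈ L v ∧ c v ∈ Q) ∧
      (∀ e ∈ E, (∀ v ∈ e, v ∉ W) → ¬ Monochromatic c e) ∧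
      ∀ q ∉ Q, (W.filter fun v => q ∈ L v).card < u := by
  suffices H : ∀ (W : Finset V) (Q : Finset ℕ) (c : V → ℕ),
      s * Q.card + W.card = Fintype.card V → (∀ v ∉ W, c v ∈ L v ∧ c v ∈ Q) →
      (∀ e ∈ E, (∀ v ∈ e, v ∉ W) → ¬ Monochromatic c e) →
      ∃ (W : Finset V) (Q : Finset ℕ) (c : V → ℕ), s * Q.card + W.card = Fintype.card V ∧
      (∀ v ∉ W, c v ∈ L v ∧ c v ∈ Q) ∧
      (∀ e ∈ E, (∀ v ∈ e, v ∉ W) → ¬ Monochromatic c e) ∧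
      ∀ q ∉ Q, (W.filter fun v => q ∈ L v).card < u by
    refine H Finset.univ ∅ (fun _ => 0) (by simp) (by simp) ?_
    intro e he h
    obtain ⟨v, hv⟩ := hE e he
    simpa using h v hv
  intro W
  induction W using Finset.strongInduction with
  | H W ih =>
  intro Q c h1 h2 h3
  by_cases h4 : ∀ q ∉ Q, (W.filter fun v => q ∈ L v).card < u
  · exact ⟨W, Q, c, h1, h2, h3, h4⟩
  push Not at h4
  obtain ⟨q, hq, hu⟩ := h4
  obtain ⟨I, hI, hIs, hIE⟩ := hA _ hu
  have hIW : I ⊆ W := hI.trans (Finset.filter_subset _ _)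
  have hIne : I.Nonempty := Finset.card_pos.1 (by omega)
  refine ih (W \ I) (Finset.sdiff_ssubset hIW hIne) (insert q Q)
    (fun v => if v ∈ I then q else c v) ?_ ?_ ?_
  · rw [Finset.card_insert_of_notMem hq, Finset.card_sdiff_of_subset hIW]
    have := Finset.card_le_card hIW
    rw [hIs] at this ⊢
    rw [← h1, mul_add]
    omega
  · intro v hv
    by_cases hvI : v ∈ I
    · simpa [hvI] using (Finset.mem_filter.1 (hI hvI)).2
    · have := h2 v (fun h => hv (Finset.mem_sdiff.2 ⟨h, hvI⟩))
      simp [hvI, this]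
  · intro e he hv hmono
    by_cases hex : ∃ a ∈ e, a ∈ I
    · obtain ⟨a, hae, haI⟩ := hex
      refine hIE e he fun b hb => ?_
      by_contra hbI
      have h5 := hmono a hae b hb
      simp only [haI, hbI, if_true, if_false] at h5
      have h6 := (h2 b (fun h => hv b hb (Finset.mem_sdiff.2 ⟨h, hbI⟩))).2
      exact hq (h5 ▸ h6)
    · push Not at hex
      refine h3 e he (fun v hve h => hv v hve (Finset.mem_sdiff.2 ⟨h, hex v hve⟩)) ?_
      intro a ha b hb
      simpa [hex a ha, hex b hb] using hmono a ha b hb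

theorem rChoosable_of_quasirandom {E : Finset (Finset V)} {k r a s u M y : ℕ}
    (hE : ∀ e ∈ E, e.card = k) (hk : 2 ≤ k) (hs : 0 < s) (hy : 0 < y)
    (har : a + 8 * (k ^ 2 * y) ≤ r) (has : Fintype.card V ≤ s * a)
    (hA : ∀ U : Finset V, u ≤ U.card → ∃ I ⊆ U, I.card = s ∧ ∀ e ∈ E, ¬ e ⊆ I)
    (hB : ∀ U T : Finset V, T ⊆ U → U.card < u →
      (∀ v ∈ T, M ≤ (E.filter fun e => v ∈ e ∧ e ⊆ U).card) → M * T.card ≤ 4 * k * U.card)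
    (hC : ∀ S : Finset V, M * S.card ≤ 16 * k * Fintype.card V →
      (E.filter fun e => 2 ≤ (e ∩ S).card).card ≤ y * S.card)
    (hM : 2 * M ≤ (k ^ 2 * y) ^ (k - 1)) : RChoosable r E := by
  intro L hL
  have hne : ∀ e ∈ E, e.Nonempty := fun e he => Finset.card_pos.1 (by rw [hE e he]; omega)
  obtain ⟨W, Q, c₀, hQ, hc₀, hc₀E, hu⟩ := exists_partial_coloring hne hs L hA
  have hQa : Q.card ≤ a := Nat.le_of_mul_le_mul_left (by omega : s * Q.card ≤ s * a) hs
  set h := k ^ 2 * y with hh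
  have hh0 : 0 < h := by positivity
  have hex : ∀ v, ∃ l ⊆ L v \ Q, l.card = 8 * h := by
    intro v
    refine Finset.exists_subset_card_eq ?_
    have := Finset.le_card_sdiff Q (L v)
    rw [hL v] at this
    omega
  choose L₁ hL₁ hL₁c using hex
  set U : ℕ → Finset V := fun q => W.filter fun v => q ∈ L₁ v with hU
  set D : ℕ → Finset V := fun q => (U q).filter fun v =>
    M ≤ (E.filter fun e => v ∈ e ∧ e ⊆ U q).card with hD
  have hDU : ∀ q, (∃ v, q ∈ L₁ v) → M * (D q).card ≤ 4 * k * (U q).card := by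
    rintro q ⟨w, hw⟩
    refine hB (U q) (D q) (Finset.filter_subset _ _) ?_ fun v hv => (Finset.mem_filter.1 hv).2
    refine lt_of_le_of_lt (Finset.card_le_card ?_) (hu q (Finset.mem_sdiff.1 (hL₁ w hw)).2)
    intro v hv
    simp only [hU, Finset.mem_filter] at hv ⊢
    exact ⟨hv.1, (Finset.mem_sdiff.1 (hL₁ v hv.2)).1⟩
  set B := W.filter fun v => 4 * h ≤ ((L₁ v).filter fun q => v ∈ D q).card with hB'
  have hBcard : M * B.card ≤ 8 * k * Fintype.card V := by
    set P := W.biUnion L₁ with hP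
    have e1 : 4 * h * B.card ≤ ∑ q ∈ P, (D q).card := by
      calc 4 * h * B.card = ∑ v ∈ B, 4 * h := by rw [Finset.sum_const, smul_eq_mul, mul_comm]
        _ ≤ ∑ v ∈ B, ((L₁ v).filter fun q => v ∈ D q).card :=
          Finset.sum_le_sum fun v hv => (Finset.mem_filter.1 hv).2
        _ ≤ ∑ v ∈ W, ((L₁ v).filter fun q => v ∈ D q).card :=
          Finset.sum_le_sum_of_subset (Finset.filter_subset _ _)
        _ ≤ ∑ v ∈ W, (P.filter fun q => v ∈ D q).card := by
          refine Finset.sum_le_sum fun v hv => Finset.card_le_card ?_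
          exact Finset.filter_subset_filter _ (Finset.subset_biUnion_of_mem L₁ hv)
        _ = ∑ q ∈ P, (W.filter fun v => v ∈ D q).card := by
          simp only [Finset.card_filter]
          exact Finset.sum_comm
        _ ≤ ∑ q ∈ P, (D q).card := by
          refine Finset.sum_le_sum fun q _ => Finset.card_le_card fun v hv => ?_
          exact (Finset.mem_filter.1 hv).2
    have e2 : ∑ q ∈ P, (U q).card ≤ 8 * h * Fintype.card V := by
      calc ∑ q ∈ P, (U q).card = ∑ v ∈ W, (P.filter fun q => q ∈ L₁ v).card := by
            simp only [hU, Finset.card_filter]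
            exact Finset.sum_comm
        _ ≤ ∑ v ∈ W, (L₁ v).card := by
            refine Finset.sum_le_sum fun v _ => Finset.card_le_card fun q hq => ?_
            exact (Finset.mem_filter.1 hq).2
        _ = W.card * (8 * h) := by
            rw [Finset.sum_congr rfl fun v _ => hL₁c v, Finset.sum_const, smul_eq_mul]
        _ ≤ Fintype.card V * (8 * h) := by gcongr; exact Finset.card_le_univ W
        _ = _ := by ring
    have e3 : M * ∑ q ∈ P, (D q).card ≤ 4 * k * ∑ q ∈ P, (U q).card := by
      rw [Finset.mul_sum, Finset.mul_sum]
      refine Finset.sum_le_sum fun q hq => hDU q ?_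
      obtain ⟨v, _, hv⟩ := Finset.mem_biUnion.1 hq
      exact ⟨v, hv⟩
    refine Nat.le_of_mul_le_mul_left (?_ : 4 * h * _ ≤ 4 * h * _) (by positivity)
    calc 4 * h * (M * B.card) = M * (4 * h * B.card) := by ring
      _ ≤ M * ∑ q ∈ P, (D q).card := by gcongr
      _ ≤ 4 * k * ∑ q ∈ P, (U q).card := e3
      _ ≤ 4 * k * (8 * h * Fintype.card V) := by gcongr
      _ = _ := by ring
  have hsmall : ∀ T : Finset V, T.card ≤ 2 * B.card →
      (E.filter fun e => 2 ≤ (e ∩ T).card).card ≤ y * T.card := by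
    intro T hT
    refine hC T ?_
    calc M * T.card ≤ M * (2 * B.card) := by gcongr
      _ = 2 * (M * B.card) := by ring
      _ ≤ 2 * (8 * k * Fintype.card V) := by gcongr
      _ = _ := by ring
  obtain ⟨S, hBS, hSW, hScard, hSdeg⟩ :=
    exists_closure hE W B (Finset.filter_subset _ _) hsmall
  obtain ⟨c₁, hc₁, hc₁E⟩ := exists_coloring_of_sparse hE (L := L₁) S
    (fun v _ => by rw [hL₁c v, hh]; nlinarith [hh0])
    (fun T hT => hsmall T ((Finset.card_le_card hT).trans hScard))
  set X : V → Finset ℕ := fun v =>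
    ((E.filter fun e => v ∈ e ∧ (e ∩ S).Nonempty).biUnion fun e => e ∩ S).image c₁ with hX
  have hXcard : ∀ v ∈ W \ S, (X v).card ≤ 2 * h := by
    intro v hv
    rw [Finset.mem_sdiff] at hv
    refine Finset.card_image_le.trans ((Finset.card_biUnion_le_card_mul _ _ k ?_).trans ?_)
    · intro e he
      rw [← hE e (Finset.mem_filter.1 he).1]
      exact Finset.card_le_card Finset.inter_subset_left
    · calc _ ≤ 2 * k * y * k := by gcongr; exact hSdeg v hv.1 hv.2
        _ = _ := by rw [hh]; ring
  have hex₂ : ∀ v, ∃ l : Finset ℕ, v ∈ W \ S →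
      l ⊆ ((L₁ v).filter fun q => v ∉ D q) \ X v ∧ l.card = 2 * h := by
    intro v
    by_cases hv : v ∈ W \ S
    · have e1 := Finset.le_card_sdiff (X v) ((L₁ v).filter fun q => v ∉ D q)
      have e2 := Finset.card_filter_add_card_filter_not (s := L₁ v) (fun q => v ∈ D q)
      have e3 := hXcard v hv
      rw [Finset.mem_sdiff] at hv
      have e4 : ((L₁ v).filter fun q => v ∈ D q).card < 4 * h := by
        by_contra! hcon
        exact hv.2 (hBS (Finset.mem_filter.2 ⟨hv.1, hcon⟩))
      rw [hL₁c v] at e2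
      obtain ⟨l, hl⟩ := Finset.exists_subset_card_eq
        (s := ((L₁ v).filter fun q => v ∉ D q) \ X v) (n := 2 * h) (by omega)
      exact ⟨l, fun _ => hl⟩
    · exact ⟨∅, fun h => absurd h hv⟩
  choose L₂ hL₂ using hex₂
  have hL₂mem : ∀ v ∈ W \ S, ∀ q ∈ L₂ v, q ∈ L₁ v ∧ v ∉ D q ∧ q ∉ X v := by
    intro v hv q hq
    have := (hL₂ v hv).1 hq
    simp only [Finset.mem_sdiff, Finset.mem_filter] at this
    exact ⟨this.1.1, this.1.2, this.2⟩
  obtain ⟨c₂, hc₂, hc₂E⟩ := exists_coloring_of_colorDegree_le hE (by omega) (W := W \ S)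
    (L := L₂) hh0 (fun v hv => (hL₂ v hv).2) (M := M) (by
      intro v hv q hq
      obtain ⟨hq1, hqD, _⟩ := hL₂mem v hv q hq
      have hvU : v ∈ U q := Finset.mem_filter.2 ⟨(Finset.mem_sdiff.1 hv).1, hq1⟩
      have : ¬ M ≤ (E.filter fun e => v ∈ e ∧ e ⊆ U q).card := fun hcon =>
        hqD (Finset.mem_filter.2 ⟨hvU, hcon⟩)
      refine le_trans (Finset.card_le_card fun e he => ?_) (not_le.1 this).le
      simp only [Finset.mem_filter] at he ⊢
      refine ⟨he.1, he.2.1, fun w hw => ?_⟩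
      obtain ⟨hw1, hw2⟩ := he.2.2 w hw
      exact Finset.mem_filter.2 ⟨(Finset.mem_sdiff.1 hw1).1, (hL₂mem w hw1 q hw2).1⟩) hM
  set c : V → ℕ := fun v => if v ∈ S then c₁ v else if v ∈ W then c₂ v else c₀ v with hc
  have hcS : ∀ v ∈ S, c v = c₁ v := fun v hv => by simp [hc, hv]
  have hcW : ∀ v ∈ W \ S, c v = c₂ v := fun v hv => by
    rw [Finset.mem_sdiff] at hv; simp [hc, hv]
  have hcO : ∀ v ∉ W, c v = c₀ v := fun v hv => by
    have : v ∉ S := fun h => hv (hSW h)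
    simp [hc, hv, this]
  have hcL₁ : ∀ v ∈ W, c v ∈ L₁ v := by
    intro v hv
    by_cases hvS : v ∈ S
    · rw [hcS v hvS]; exact hc₁ v hvS
    · have hvW : v ∈ W \ S := Finset.mem_sdiff.2 ⟨hv, hvS⟩
      rw [hcW v hvW]
      exact (hL₂mem v hvW _ (hc₂ v hvW)).1
  refine ⟨c, fun v => ?_, fun e he hmono => ?_⟩
  · by_cases hv : v ∈ W
    · exact (Finset.mem_sdiff.1 (hL₁ v (hcL₁ v hv))).1
    · rw [hcO v hv]; exact (hc₀ v hv).1
  by_cases heW : e ⊆ W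
  · by_cases h2 : 2 ≤ (e ∩ S).card
    · obtain ⟨x, hx, z, hz, hxz⟩ := hc₁E e he h2
      rw [Finset.mem_inter] at hx hz
      have := hmono x hx.1 z hz.1
      rw [hcS x hx.2, hcS z hz.2] at this
      exact hxz this
    rcases (e ∩ S).eq_empty_or_nonempty with h0 | ⟨b, hb⟩
    · have heS : ∀ v ∈ e, v ∈ W \ S := fun v hv => Finset.mem_sdiff.2 ⟨heW hv, fun hvS => by
        have : v ∈ e ∩ S := Finset.mem_inter.2 ⟨hv, hvS⟩
        simp [h0] at this⟩
      refine hc₂E e he heS fun x hx z hz => ?_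
      rw [← hcW x (heS x hx), ← hcW z (heS z hz)]
      exact hmono x hx z hz
    · obtain ⟨v, hve, hvS⟩ : ∃ v ∈ e, v ∉ e ∩ S :=
        Finset.exists_mem_notMem_of_card_lt_card (by rw [hE e he]; omega)
      have hvW : v ∈ W \ S := Finset.mem_sdiff.2
        ⟨heW hve, fun h => hvS (Finset.mem_inter.2 ⟨hve, h⟩)⟩
      refine (hL₂mem v hvW _ (hc₂ v hvW)).2.2 ?_
      rw [← hcW v hvW, hmono v hve b (Finset.mem_inter.1 hb).1, hcS b (Finset.mem_inter.1 hb).2]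
      refine Finset.mem_image_of_mem c₁ (Finset.mem_biUnion.2 ⟨e, ?_, hb⟩)
      exact Finset.mem_filter.2 ⟨he, hve, b, hb⟩
  · obtain ⟨x, hxe, hxW⟩ := Finset.not_subset.1 heW
    by_cases hout : ∀ v ∈ e, v ∉ W
    · refine hc₀E e he hout fun p hp q hq => ?_
      rw [← hcO p (hout p hp), ← hcO q (hout q hq)]
      exact hmono p hp q hq
    · push Not at hout
      obtain ⟨z, hze, hzW⟩ := hout
      have h1 := (Finset.mem_sdiff.1 (hL₁ z (hcL₁ z hzW))).2
      rw [← hmono x hxe z hze, hcO x hxW] at h1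
      exact h1 (hc₀ x hxW).2

end Deterministic

section RandomHypergraph

/-- In a set without independent subsets of size `s`, one can successively remove `J` small
maximal independent sets; the labels `0`, `1` and `j + 2` mark the vertices outside `U`, the
remaining vertices, and the vertices of the `j`-th independent set. -/
lemma exists_labeling_of_no_independent {V : Type*} [Fintype V] [DecidableEq V]
    {E : Finset (Finset V)} (hE : ∀ e ∈ E, e.Nonempty) {s : ℕ} (J : ℕ) :
    ∀ U : Finset V, (∀ I ⊆ U, I.card = s → ∃ e ∈ E, e ⊆ I) →
      ∃ g : V → ℕ, (∀ v, g v < J + 2) ∧ (∀ v, g v = 0 ↔ v ∉ U) ∧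
        (∀ j < J, (Finset.univ.filter fun v => g v = j + 2).card ≤ s) ∧
        ∀ v, g v = 1 → ∀ j < J, ∃ e ∈ E, v ∈ e ∧ ∀ w ∈ e, w ≠ v → g w = j + 2 := by
  induction J with
  | zero =>
    intro U _
    refine ⟨fun v => if v ∈ U then 1 else 0, fun v => ?_, fun v => ?_, by simp, by simp⟩
    · dsimp only; split_ifs <;> omega
    · by_cases hv : v ∈ U <;> simp [hv]
  | succ J ih =>
    intro U hU
    obtain ⟨I, hI, hmax⟩ := Finset.exists_max_image
      (U.powerset.filter fun I => ∀ e ∈ E, ¬ e ⊆ I) Finset.card ⟨∅, by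
        simp only [Finset.mem_filter, Finset.mem_powerset, Finset.empty_subset, true_and,
          Finset.subset_empty]
        exact fun e he => (hE e he).ne_empty⟩
    simp only [Finset.mem_filter, Finset.mem_powerset] at hI hmax
    have hIs : I.card ≤ s := by
      by_contra! hlt
      obtain ⟨I', hI', hc⟩ := Finset.exists_subset_card_eq hlt.le
      obtain ⟨e, he, heI⟩ := hU I' (hI'.trans hI.1) hc
      exact hI.2 e he (heI.trans hI')
    obtain ⟨g, hg1, hg2, hg3, hg4⟩ := ih (U \ I) fun I' hI' =>
      hU I' (hI'.trans Finset.sdiff_subset)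
    have hgI : ∀ v ∈ I, g v = 0 := fun v hv => (hg2 v).2 (by simp [hv])
    refine ⟨fun v => if v ∈ I then J + 2 else g v, fun v => ?_, fun v => ?_, fun j hj => ?_,
      fun v hv j hj => ?_⟩
    · have := hg1 v
      dsimp only; split_ifs <;> omega
    · by_cases hv : v ∈ I
      · simp [hv, hI.1 hv]
      · simp [hv, hg2 v]
    · rcases Nat.lt_succ_iff_lt_or_eq.1 hj with hj | rfl
      · refine (Finset.card_le_card fun v hv => ?_).trans (hg3 j hj)
        simp only [Finset.mem_filter, Finset.mem_univ, true_and] at hv ⊢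
        split_ifs at hv
        · omega
        · exact hv
      · refine (Finset.card_le_card fun v hv => ?_).trans hIs
        simp only [Finset.mem_filter, Finset.mem_univ, true_and] at hv
        by_contra hvI
        rw [if_neg hvI] at hv
        have := hg1 v
        omega
    · have hvI : v ∉ I := by
        intro h
        simp only [h, if_true] at hv
        omega
      simp only [hvI, if_false] at hv
      have hvU : v ∈ U := by
        by_contra h
        have := (hg2 v).2 (by simp [h])
        omega
      rcases Nat.lt_succ_iff_lt_or_eq.1 hj with hj | rfl
      · obtain ⟨e, he, hve, hw⟩ := hg4 v hv j hj
        refine ⟨e, he, hve, fun w hwe hwv => ?_⟩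
        have h1 := hw w hwe hwv
        have hwI : w ∉ I := fun h => by
          have := hgI w h
          omega
        simpa [hwI] using h1
      · have hbig : ¬ (insert v I ⊆ U ∧ ∀ e ∈ E, ¬ e ⊆ insert v I) := by
          intro h
          have := hmax _ h
          rw [Finset.card_insert_of_notMem hvI] at this
          omega
        have : ∃ e ∈ E, e ⊆ insert v I := by
          by_contra! h
          exact hbig ⟨Finset.insert_subset hvU hI.1, h⟩
        obtain ⟨e, he, heI⟩ := this
        refine ⟨e, he, ?_, fun w hwe hwv => ?_⟩
        · by_contra hve
          exact hI.2 e he fun w hw =>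
            Finset.mem_of_mem_insert_of_ne (heI hw) (by rintro rfl; exact hve hw)
        · simp [Finset.mem_of_mem_insert_of_ne (heI hwe) hwv]

variable {n k : ℕ} {p : ℝ}

lemma bernProb_blocked_le (hk : 2 ≤ k) (h0 : 0 ≤ p) (h1 : p ≤ 1) {s J m : ℕ}
    (R : Finset (Fin n)) (I : Fin J → Finset (Fin n)) (hR : m ≤ R.card)
    (hI : ∀ j, (I j).card ≤ s) (hRI : ∀ j, Disjoint R (I j))
    (hII : ∀ i j, i ≠ j → Disjoint (I i) (I j)) :
    bernProb ((Finset.univ : Finset (Fin n)).powersetCard k) p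
      (fun E => ∀ v ∈ R, ∀ j, ∃ e ∈ E, v ∈ e ∧ ∀ w ∈ e, w ≠ v → w ∈ I j) ≤
    Real.exp (-((1 - p) ^ (s.choose (k - 1)) * (J * m))) := by
  set F : Fin n × Fin J → Finset (Finset (Fin n)) := fun i =>
    ((I i.2).powersetCard (k - 1)).image (insert i.1) with hF
  have hnot : ∀ v ∈ R, ∀ j, v ∉ I j := fun v hv j => Finset.disjoint_left.1 (hRI j) hv
  have h1p : 0 ≤ 1 - p := by linarith
  set q := (1 - p) ^ (s.choose (k - 1)) with hq
  have hq0 : 0 ≤ q := by positivity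
  have hq1 : q ≤ 1 := pow_le_one₀ h1p (by linarith)
  calc _ ≤ bernProb ((Finset.univ : Finset (Fin n)).powersetCard k) p
        (fun E => ∀ i ∈ R ×ˢ (Finset.univ : Finset (Fin J)), ∃ e ∈ F i, e ∈ E) := by
        refine bernProb_mono h0 h1 fun E hE h i hi => ?_
        obtain ⟨e, he, hve, hw⟩ := h i.1 (Finset.mem_product.1 hi).1 i.2
        refine ⟨e, Finset.mem_image.2 ⟨e.erase i.1, Finset.mem_powersetCard.2 ⟨?_, ?_⟩,
          Finset.insert_erase hve⟩, he⟩
        · intro w hwe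
          rw [Finset.mem_erase] at hwe
          exact hw w hwe.2 hwe.1
        · rw [Finset.card_erase_of_mem hve, (Finset.mem_powersetCard.1 (hE he)).2]
    _ = ∏ i ∈ R ×ˢ (Finset.univ : Finset (Fin J)), (1 - (1 - p) ^ (F i).card) := by
        refine bernProb_forall_exists_mem _ F _ ?_ ?_
        · rintro ⟨v, j⟩ hi e he
          obtain ⟨f, hf, rfl⟩ := Finset.mem_image.1 he
          rw [Finset.mem_powersetCard] at hf ⊢
          have hvf : v ∉ f := fun h => hnot v (Finset.mem_product.1 hi).1 j (hf.1 h)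
          refine ⟨Finset.subset_univ _, ?_⟩
          rw [Finset.card_insert_of_notMem hvf, hf.2]
          omega
        · rintro ⟨v, j⟩ hi ⟨v', j'⟩ hi' hne
          rw [Finset.mem_product] at hi hi'
          rw [Finset.disjoint_left]
          intro e he he'
          obtain ⟨f, hf, rfl⟩ := Finset.mem_image.1 he
          obtain ⟨f', hf', hff'⟩ := Finset.mem_image.1 he'
          rw [Finset.mem_powersetCard] at hf hf'
          dsimp only at hff' hi hi' hf hf'
          have hv : v = v' := by
            have : v ∈ insert v' f' := by rw [hff']; simp
            rcases Finset.mem_insert.1 this with h | h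
            · exact h
            · exact absurd (hf'.1 h) (hnot v hi.1 j')
          subst hv
          have hj : j ≠ j' := fun h => hne (by rw [h])
          obtain ⟨w, hw⟩ : f.Nonempty := Finset.card_pos.1 (by omega)
          have hwv : w ≠ v := by rintro rfl; exact hnot w hi.1 j (hf.1 hw)
          have hw' : w ∈ f' := by
            refine Finset.mem_of_mem_insert_of_ne (?_ : w ∈ insert v f') hwv
            rw [hff']; simp [hw]
          exact Finset.disjoint_left.1 (hII j j' hj) (hf.1 hw) (hf'.1 hw')
    _ ≤ ∏ i ∈ R ×ˢ (Finset.univ : Finset (Fin J)), Real.exp (-q) := by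
        refine Finset.prod_le_prod (fun i _ => ?_) fun i _ => ?_
        · have : (1 - p) ^ (F i).card ≤ 1 := pow_le_one₀ h1p (by linarith)
          linarith
        · have hc : (F i).card ≤ s.choose (k - 1) := by
            refine Finset.card_image_le.trans ?_
            rw [Finset.card_powersetCard]
            exact Nat.choose_le_choose _ (hI i.2)
          have hpow : q ≤ (1 - p) ^ (F i).card := pow_le_pow_of_le_one h1p (by linarith) hc
          have := Real.add_one_le_exp (-q)
          linarith
    _ = Real.exp (-(q * (J * R.card))) := by
        rw [Finset.prod_const, ← Real.exp_nat_mul, Finset.card_product, Finset.card_univ,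
          Fintype.card_fin]
        congr 1
        push_cast
        ring
    _ ≤ _ := by
        have : (m : ℝ) ≤ R.card := by exact_mod_cast hR
        gcongr

lemma bernProb_no_independent_le (hk : 2 ≤ k) (h0 : 0 ≤ p) (h1 : p ≤ 1) (s u J : ℕ) :
    bernProb ((Finset.univ : Finset (Fin n)).powersetCard k) p
      (fun E => ¬ ∀ U : Finset (Fin n), u ≤ U.card →
        ∃ I ⊆ U, I.card = s ∧ ∀ e ∈ E, ¬ e ⊆ I) ≤
    ((J : ℝ) + 2) ^ n *
      Real.exp (-((1 - p) ^ (s.choose (k - 1)) * (J * ((u - J * s : ℕ) : ℝ)))) := by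
  set R : (Fin n → Fin (J + 2)) → Finset (Fin n) := fun g =>
    Finset.univ.filter fun v => (g v : ℕ) = 1 with hR
  set I : (Fin n → Fin (J + 2)) → Fin J → Finset (Fin n) := fun g j =>
    Finset.univ.filter fun v => (g v : ℕ) = j + 2 with hI
  refine (bernProb_le_sum h0 h1 (Finset.univ : Finset (Fin n → Fin (J + 2)))
    (Q := fun g E => (u - J * s ≤ (R g).card ∧ ∀ j, (I g j).card ≤ s) ∧
      ∀ v ∈ R g, ∀ j, ∃ e ∈ E, v ∈ e ∧ ∀ w ∈ e, w ≠ v → w ∈ I g j) ?_).trans ?_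
  · intro E hE hno
    push Not at hno
    obtain ⟨U, hU, hUE⟩ := hno
    have hne : ∀ e ∈ E, e.Nonempty := fun e he => Finset.card_pos.1 (by
      rw [(Finset.mem_powersetCard.1 (hE he)).2]; omega)
    obtain ⟨g, hg1, hg2, hg3, hg4⟩ := exists_labeling_of_no_independent hne J U hUE
    refine ⟨fun v => ⟨g v, hg1 v⟩, Finset.mem_univ _, ⟨?_, ?_⟩, ?_⟩
    · have hsub : U ⊆ R (fun v => ⟨g v, hg1 v⟩) ∪
          Finset.univ.biUnion (I fun v => ⟨g v, hg1 v⟩) := by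
        intro v hv
        have h2 : g v ≠ 0 := fun h => (hg2 v).1 h hv
        have h3 := hg1 v
        simp only [hR, hI, Finset.mem_union, Finset.mem_biUnion, Finset.mem_filter,
          Finset.mem_univ, true_and]
        by_cases h4 : g v = 1
        · exact Or.inl h4
        · exact Or.inr ⟨⟨g v - 2, by omega⟩, by simp only; omega⟩
      have h5 := (Finset.card_le_card hsub).trans (Finset.card_union_le _ _)
      have h6 : (Finset.univ.biUnion (I fun v => ⟨g v, hg1 v⟩)).card ≤ J * s := by
        have h7 : ∀ j ∈ (Finset.univ : Finset (Fin J)),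
            (I (fun v => ⟨g v, hg1 v⟩) j).card ≤ s := fun j _ => hg3 j j.2
        simpa using Finset.card_biUnion_le_card_mul _ _ s h7
      omega
    · exact fun j => hg3 j j.2
    · intro v hv j
      obtain ⟨e, he, hve, hw⟩ := hg4 v (Finset.mem_filter.1 hv).2 j j.2
      exact ⟨e, he, hve, fun w hwe hwv => Finset.mem_filter.2 ⟨Finset.mem_univ _, hw w hwe hwv⟩⟩
  · refine (Finset.sum_le_card_nsmul _ _
      (Real.exp (-((1 - p) ^ (s.choose (k - 1)) * (J * ((u - J * s : ℕ) : ℝ))))) ?_).trans ?_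
    · intro g _
      by_cases hc : u - J * s ≤ (R g).card ∧ ∀ j, (I g j).card ≤ s
      · refine (bernProb_mono h0 h1 fun E _ h => h.2).trans
          (bernProb_blocked_le hk h0 h1 (R g) (I g) hc.1 hc.2 ?_ ?_)
        · intro j
          rw [Finset.disjoint_left]
          intro v hv hv'
          have e1 := (Finset.mem_filter.1 hv).2
          have e2 := (Finset.mem_filter.1 hv').2
          omega
        · intro i j hij
          rw [Finset.disjoint_left]
          intro v hv hv'
          have e1 := (Finset.mem_filter.1 hv).2
          have e2 := (Finset.mem_filter.1 hv').2
          exact hij (Fin.ext (by omega))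
      · simp only [hc, false_and]
        simpa [bernProb] using (Real.exp_pos _).le
    · rw [nsmul_eq_mul, Finset.card_univ, Fintype.card_fun, Fintype.card_fin, Fintype.card_fin]
      push_cast
      exact le_rfl

lemma sum_small_sets_le (hn : 0 < n) (𝒰 : Finset (Finset (Fin n))) (w : Finset (Fin n) → ℝ)
    (h𝒰 : ∀ U ∈ 𝒰, U.Nonempty)
    (hw : ∀ U ∈ 𝒰, w U ≤ (((U.card : ℝ) / n) ^ 2 / 12) ^ U.card) :
    ∑ U ∈ 𝒰, w U ≤ 2 / n := by
  have hn' : (0 : ℝ) < n := by exact_mod_cast hn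
  set f : ℕ → ℝ := fun σ => if σ = 0 then 0 else (((σ : ℝ) / n) ^ 2 / 12) ^ σ with hf
  have hf0 : ∀ σ, 0 ≤ f σ := by
    intro σ
    simp only [hf]
    split_ifs <;> positivity
  calc ∑ U ∈ 𝒰, w U ≤ ∑ U ∈ 𝒰, f U.card := by
        refine Finset.sum_le_sum fun U hU => (hw U hU).trans_eq ?_
        simp [hf, (h𝒰 U hU).ne_empty]
    _ ≤ ∑ U ∈ (Finset.univ : Finset (Fin n)).powerset, f U.card :=
        Finset.sum_le_sum_of_subset_of_nonneg (fun U _ => by simp) fun U _ _ => hf0 _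
    _ = ∑ σ ∈ Finset.range (n + 1), (n.choose σ : ℝ) * f σ := by
        rw [Finset.sum_powerset_apply_card]
        simp [nsmul_eq_mul]
    _ ≤ ∑ σ ∈ Finset.range (n + 1), (1 / n) * (1 / 2 : ℝ) ^ σ := by
        refine Finset.sum_le_sum fun σ hσ => ?_
        rcases Nat.eq_zero_or_pos σ with rfl | hσ0
        · simp [hf]
        have hσ' : (0 : ℝ) < σ := by exact_mod_cast hσ0
        have hσn : (σ : ℝ) / n ≤ 1 := by
          rw [div_le_one hn']
          exact_mod_cast Nat.lt_succ_iff.1 (Finset.mem_range.1 hσ)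
        have h2 : (σ : ℝ) ≤ 2 ^ σ := by exact_mod_cast Nat.lt_two_pow_self.le
        simp only [hf, hσ0.ne', if_false]
        calc (n.choose σ : ℝ) * (((σ : ℝ) / n) ^ 2 / 12) ^ σ
            ≤ (3 * n / σ) ^ σ * (((σ : ℝ) / n) ^ 2 / 12) ^ σ := by
              gcongr; exact choose_le_three_mul_div_pow n σ
          _ = ((1 / 4) * ((σ : ℝ) / n)) ^ σ := by
              rw [← mul_pow]; congr 1; field_simp; norm_num
          _ = (1 / 4) ^ σ * ((σ : ℝ) / n) ^ σ := mul_pow _ _ _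
          _ ≤ (1 / 4) ^ σ * ((σ : ℝ) / n) := by
              gcongr
              exact pow_le_of_le_one (by positivity) hσn hσ0.ne'
          _ ≤ (1 / 4) ^ σ * ((2 : ℝ) ^ σ / n) := by gcongr
          _ = (1 / n) * (1 / 2 : ℝ) ^ σ := by
              rw [show (1 / 2 : ℝ) = (1 / 4) * 2 by norm_num, mul_pow]; ring
    _ ≤ (1 / n) * 2 := by
        rw [← Finset.mul_sum]
        gcongr
        exact sum_geometric_two_le _
    _ = 2 / n := by ring

lemma bernProb_high_degree_le (hn : 0 < n) (hk : 0 < k) (h0 : 0 ≤ p) (h1 : p ≤ 1) {u M : ℕ}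
    (hM : 0 < M)
    (hp : ∀ σ : ℕ, 0 < σ → σ < u → 3 * k * (σ : ℝ) ^ (k - 1) * p ≤ M * (σ / n) ∧
      24 * ((σ : ℝ) / n) ^ 2 ≤ 1) :
    bernProb ((Finset.univ : Finset (Fin n)).powersetCard k) p
      (fun E => ¬ ∀ U T : Finset (Fin n), T ⊆ U → U.card < u →
        (∀ v ∈ T, M ≤ (E.filter fun e => v ∈ e ∧ e ⊆ U).card) → M * T.card ≤ 4 * k * U.card) ≤
    2 / n := by
  have hn' : (0 : ℝ) < n := by exact_mod_cast hn
  have hM' : (0 : ℝ) < M := by exact_mod_cast hM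
  have hk' : (0 : ℝ) < k := by exact_mod_cast hk
  set Ω := (Finset.univ : Finset (Fin n)).powersetCard k with hΩ
  set F : Finset (Fin n) → Finset (Fin n) → Finset (Finset (Fin n)) := fun U T =>
    Ω.filter fun e => e ⊆ U ∧ (e ∩ T).Nonempty with hF
  set m : Finset (Fin n) → ℕ := fun T => ⌈(T.card * M : ℝ) / k⌉₊ with hm
  set 𝒯 : Finset (Fin n) → Finset (Finset (Fin n)) := fun U =>
    U.powerset.filter fun T => 4 * k * U.card < M * T.card with h𝒯
  have hFcard : ∀ U T, (F U T).card ≤ T.card * U.card ^ (k - 1) := by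
    intro U T
    have hsub : F U T ⊆ T.biUnion fun v => (U.powersetCard (k - 1)).image (insert v) := by
      intro e he
      simp only [hF, hΩ, Finset.mem_filter, Finset.mem_powersetCard] at he
      obtain ⟨v, hv⟩ := he.2.2
      rw [Finset.mem_inter] at hv
      refine Finset.mem_biUnion.2 ⟨v, hv.2, Finset.mem_image.2 ⟨e.erase v,
        Finset.mem_powersetCard.2 ⟨(Finset.erase_subset _ _).trans he.2.1, ?_⟩,
        Finset.insert_erase hv.1⟩⟩
      rw [Finset.card_erase_of_mem hv.1, he.1.2]
    refine (Finset.card_le_card hsub).trans (Finset.card_biUnion_le_card_mul _ _ _ fun v _ => ?_)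
    refine Finset.card_image_le.trans ?_
    rw [Finset.card_powersetCard]
    exact Nat.choose_le_pow _ _
  refine (bernProb_le_sum h0 h1 (Finset.univ.filter fun U : Finset (Fin n) =>
    U.Nonempty ∧ U.card < u) (Q := fun U E => ∃ T ∈ 𝒯 U, m T ≤ (E ∩ F U T).card) ?_).trans
    (sum_small_sets_le hn _ _ (fun U hU => (Finset.mem_filter.1 hU).2.1) fun U hU => ?_)
  · intro E hE hno
    push Not at hno
    obtain ⟨U, T, hTU, hUu, hdeg, hlt⟩ := hno
    have hEk : ∀ e ∈ E, e.card = k := fun e he => (Finset.mem_powersetCard.1 (hE he)).2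
    have hTne : T.Nonempty := Finset.card_pos.1 (by
      by_contra h
      have : T.card = 0 := by omega
      simp [this] at hlt)
    refine ⟨U, Finset.mem_filter.2 ⟨Finset.mem_univ _, hTne.mono hTU, hUu⟩, T,
      Finset.mem_filter.2 ⟨Finset.mem_powerset.2 hTU, hlt⟩, ?_⟩
    have h2 := sum_card_filter_mem_le hEk T fun e => e ⊆ U
    have h3 : T.card * M ≤ ∑ v ∈ T, (E.filter fun e => v ∈ e ∧ e ⊆ U).card := by
      rw [← smul_eq_mul]
      exact Finset.card_nsmul_le_sum _ _ _ hdeg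
    have h4 : (E.filter fun e => e ⊆ U ∧ (e ∩ T).Nonempty) = E ∩ F U T := by
      ext e
      simp only [hF, Finset.mem_filter, Finset.mem_inter]
      exact ⟨fun h => ⟨h.1, hE h.1, h.2⟩, fun h => ⟨h.1, h.2.2⟩⟩
    rw [h4] at h2
    rw [hm, Nat.ceil_le, div_le_iff₀ hk']
    have h5 : ((T.card * M : ℕ) : ℝ) ≤ ((k * (E ∩ F U T).card : ℕ) : ℝ) := by
      exact_mod_cast h3.trans h2
    push_cast at h5
    linarith
  · obtain ⟨_, hUne, hUu⟩ := Finset.mem_filter.1 hU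
    obtain ⟨hp1, hp2⟩ := hp U.card hUne.card_pos hUu
    set x : ℝ := (U.card : ℝ) / n with hx
    have hU0 : (0 : ℝ) < U.card := by exact_mod_cast hUne.card_pos
    have hx0 : 0 < x := by positivity
    have hx1 : x ≤ 1 := by nlinarith
    calc _ ≤ ∑ T ∈ 𝒯 U, bernProb Ω p (fun E => m T ≤ (E ∩ F U T).card) :=
          bernProb_le_sum h0 h1 _ fun E _ h => h
      _ ≤ ∑ T ∈ 𝒯 U, x ^ (4 * U.card) := by
          refine Finset.sum_le_sum fun T hT => ?_
          have hT' := (Finset.mem_filter.1 hT).2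
          have hT'' : (4 : ℝ) * k * U.card < M * T.card := by exact_mod_cast hT'
          have hTpos : (0 : ℝ) < T.card := by
            by_contra! h
            have : (T.card : ℝ) = 0 := le_antisymm h (Nat.cast_nonneg _)
            rw [this] at hT''
            have : (0 : ℝ) < 4 * k * U.card := by positivity
            linarith
          have hmge : (T.card * M : ℝ) / k ≤ m T := Nat.le_ceil _
          have hm0 : (0 : ℝ) < m T := lt_of_lt_of_le (by positivity) hmge
          have hm4 : 4 * U.card ≤ m T := by
            have : (4 * U.card : ℝ) ≤ m T := by
              refine le_trans ?_ hmge
              rw [le_div_iff₀ hk']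
              linarith
            exact_mod_cast this
          have hFs : F U T ⊆ Ω := Finset.filter_subset _ _
          have hle : bernProb Ω p (fun E => m T ≤ (E ∩ F U T).card) ≤
              (3 * ((F U T).card : ℝ) / m T * p) ^ m T := by
            convert bernProb_le_card_inter h0 h1 hFs (m T)
          refine hle.trans ?_
          refine le_trans (pow_le_pow_left₀ (by positivity) ?_ _)
            (pow_le_pow_of_le_one hx0.le hx1 hm4)
          have hFc : ((F U T).card : ℝ) ≤ T.card * (U.card : ℝ) ^ (k - 1) := by
            exact_mod_cast hFcard U T
          calc 3 * ((F U T).card : ℝ) / m T * p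
              ≤ 3 * (T.card * (U.card : ℝ) ^ (k - 1)) / (T.card * M / k) * p := by gcongr
            _ = (3 * k * (U.card : ℝ) ^ (k - 1) * p) / M := by field_simp
            _ ≤ x := by rw [div_le_iff₀ hM']; linarith
      _ ≤ 2 ^ U.card * x ^ (4 * U.card) := by
          rw [Finset.sum_const, nsmul_eq_mul]
          gcongr
          have h𝒯U : (𝒯 U).card ≤ 2 ^ U.card :=
            (Finset.card_filter_le _ _).trans_eq (Finset.card_powerset U)
          exact_mod_cast h𝒯U
      _ = (2 * x ^ 4) ^ U.card := by rw [mul_pow, pow_mul]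
      _ ≤ (x ^ 2 / 12) ^ U.card := by
          gcongr
          nlinarith [mul_le_mul_of_nonneg_left hp2 (sq_nonneg x)]

lemma bernProb_dense_set_le (hn : 0 < n) (h0 : 0 ≤ p) (h1 : p ≤ 1) {N y : ℕ}
    (hy : 0 < y) {M : ℕ}
    (hp : ∀ σ : ℕ, 0 < σ → M * σ ≤ N →
      (3 * σ * (n : ℝ) ^ (k - 2) * p / y) ^ y ≤ ((σ : ℝ) / n) ^ 2 / 12) :
    bernProb ((Finset.univ : Finset (Fin n)).powersetCard k) p
      (fun E => ¬ ∀ S : Finset (Fin n), M * S.card ≤ N →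
        (E.filter fun e => 2 ≤ (e ∩ S).card).card ≤ y * S.card) ≤
    2 / n := by
  have hy' : (0 : ℝ) < y := by exact_mod_cast hy
  set Ω := (Finset.univ : Finset (Fin n)).powersetCard k with hΩ
  set F : Finset (Fin n) → Finset (Finset (Fin n)) := fun S =>
    Ω.filter fun e => 2 ≤ (e ∩ S).card with hF
  have hFcard : ∀ S, (F S).card ≤ S.card ^ 2 * n ^ (k - 2) := by
    intro S
    have hsub : F S ⊆ (S.powersetCard 2 ×ˢ
        (Finset.univ : Finset (Fin n)).powersetCard (k - 2)).image fun x => x.1 ∪ x.2 := by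
      intro e he
      simp only [hF, hΩ, Finset.mem_filter, Finset.mem_powersetCard] at he
      obtain ⟨f, hf, hf2⟩ := Finset.exists_subset_card_eq he.2
      have hfe : f ⊆ e := hf.trans Finset.inter_subset_left
      refine Finset.mem_image.2 ⟨(f, e \ f), Finset.mem_product.2
        ⟨Finset.mem_powersetCard.2 ⟨hf.trans Finset.inter_subset_right, hf2⟩,
          Finset.mem_powersetCard.2 ⟨Finset.subset_univ _, ?_⟩⟩, Finset.union_sdiff_of_subset hfe⟩
      dsimp only
      rw [Finset.card_sdiff_of_subset hfe, he.1.2, hf2]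
    refine (Finset.card_le_card hsub).trans (Finset.card_image_le.trans ?_)
    rw [Finset.card_product, Finset.card_powersetCard, Finset.card_powersetCard,
      Finset.card_univ, Fintype.card_fin]
    gcongr <;> exact Nat.choose_le_pow _ _
  refine (bernProb_le_sum h0 h1 (Finset.univ.filter fun S : Finset (Fin n) =>
    S.Nonempty ∧ M * S.card ≤ N) (Q := fun S E => y * S.card ≤ (E ∩ F S).card) ?_).trans
    (sum_small_sets_le hn _ _ (fun U hU => (Finset.mem_filter.1 hU).2.1) fun S hS => ?_)
  · intro E hE hno
    push Not at hno
    obtain ⟨S, hSN, hlt⟩ := hno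
    have hSne : S.Nonempty := by
      rw [Finset.nonempty_iff_ne_empty]
      rintro rfl
      simp at hlt
    refine ⟨S, Finset.mem_filter.2 ⟨Finset.mem_univ _, hSne, hSN⟩, ?_⟩
    have h4 : (E.filter fun e => 2 ≤ (e ∩ S).card) = E ∩ F S := by
      ext e
      simp only [hF, Finset.mem_filter, Finset.mem_inter]
      exact ⟨fun h => ⟨h.1, hE h.1, h.2⟩, fun h => ⟨h.1, h.2.2⟩⟩
    rw [← h4]
    exact hlt.le
  · obtain ⟨_, hSne, hSN⟩ := Finset.mem_filter.1 hS
    have hS0 : (0 : ℝ) < S.card := by exact_mod_cast hSne.card_pos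
    have hFs : F S ⊆ Ω := Finset.filter_subset _ _
    have hle : bernProb Ω p (fun E => y * S.card ≤ (E ∩ F S).card) ≤
        (3 * ((F S).card : ℝ) / (y * S.card : ℕ) * p) ^ (y * S.card) := by
      convert bernProb_le_card_inter h0 h1 hFs (y * S.card)
    refine hle.trans ?_
    rw [pow_mul]
    refine pow_le_pow_left₀ (by positivity) ?_ _
    refine le_trans (pow_le_pow_left₀ (by positivity) ?_ _) (hp S.card hSne.card_pos hSN)
    have hFc : ((F S).card : ℝ) ≤ (S.card : ℝ) ^ 2 * (n : ℝ) ^ (k - 2) := by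
      exact_mod_cast hFcard S
    calc 3 * ((F S).card : ℝ) / (y * S.card : ℕ) * p
        ≤ 3 * ((S.card : ℝ) ^ 2 * (n : ℝ) ^ (k - 2)) / (y * S.card : ℕ) * p := by gcongr
      _ = 3 * S.card * (n : ℝ) ^ (k - 2) * p / y := by
        push_cast
        field_simp

theorem one_sub_le_hyperProb_rChoosable (hn : 0 < n) (hk : 2 ≤ k) (h0 : 0 ≤ p) (h1 : p ≤ 1)
    {r a s u M y J : ℕ} (hs : 0 < s) (hy : 0 < y) (hM0 : 0 < M)
    (har : a + 8 * (k ^ 2 * y) ≤ r) (has : n ≤ s * a)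
    (hM : 2 * M ≤ (k ^ 2 * y) ^ (k - 1))
    (hp : ∀ σ : ℕ, 0 < σ → σ < u → 3 * k * (σ : ℝ) ^ (k - 1) * p ≤ M * (σ / n) ∧
      24 * ((σ : ℝ) / n) ^ 2 ≤ 1)
    (hp' : ∀ σ : ℕ, 0 < σ → M * σ ≤ 16 * k * n →
      (3 * σ * (n : ℝ) ^ (k - 2) * p / y) ^ y ≤ ((σ : ℝ) / n) ^ 2 / 12) :
    1 - (((J : ℝ) + 2) ^ n *
      Real.exp (-((1 - p) ^ (s.choose (k - 1)) * (J * ((u - J * s : ℕ) : ℝ)))) + 4 / n) ≤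
    hyperProb n k p (RChoosable r) := by
  set Ω := (Finset.univ : Finset (Fin n)).powersetCard k with hΩ
  set A : Finset (Finset (Fin n)) → Prop := fun E => ∀ U : Finset (Fin n), u ≤ U.card →
    ∃ I ⊆ U, I.card = s ∧ ∀ e ∈ E, ¬ e ⊆ I with hA
  set B : Finset (Finset (Fin n)) → Prop := fun E => ∀ U T : Finset (Fin n), T ⊆ U → U.card < u →
    (∀ v ∈ T, M ≤ (E.filter fun e => v ∈ e ∧ e ⊆ U).card) → M * T.card ≤ 4 * k * U.card with hB
  set C : Finset (Finset (Fin n)) → Prop := fun E => ∀ S : Finset (Fin n),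
    M * S.card ≤ 16 * k * n → (E.filter fun e => 2 ≤ (e ∩ S).card).card ≤ y * S.card with hC
  have hsum := bernProb_le_sum (Ω := Ω) h0 h1 (P := fun _ => True)
    (Finset.univ : Finset (Fin 4))
    (Q := ![fun E => ¬ A E, fun E => ¬ B E, fun E => ¬ C E, RChoosable r]) (by
      intro E hE _
      by_cases hAE : A E
      · by_cases hBE : B E
        · by_cases hCE : C E
          · refine ⟨3, Finset.mem_univ _, ?_⟩
            exact rChoosable_of_quasirandom
              (fun e he => (Finset.mem_powersetCard.1 (hE he)).2) hk hs hy har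
              (by simpa using has) hAE hBE (by simpa using hCE) hM
          · exact ⟨2, Finset.mem_univ _, hCE⟩
        · exact ⟨1, Finset.mem_univ _, hBE⟩
      · exact ⟨0, Finset.mem_univ _, hAE⟩)
  rw [bernProb_true, Fin.sum_univ_four] at hsum
  have e1 := bernProb_no_independent_le (n := n) hk h0 h1 s u J
  have e2 := bernProb_high_degree_le hn (by omega) h0 h1 hM0 hp
  have e3 := bernProb_dense_set_le hn h0 h1 hy hp'
  have e4 : (4 : ℝ) / n = 2 / n + 2 / n := by ring
  change 1 ≤ bernProb Ω p (fun E => ¬ A E) + bernProb Ω p (fun E => ¬ B E) +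
    bernProb Ω p (fun E => ¬ C E) + bernProb Ω p (RChoosable r) at hsum
  change _ ≤ bernProb Ω p (RChoosable r)
  linarith

end RandomHypergraph

section Asymptotics

variable {n k : ℕ} {p K R L ρ : ℝ}

lemma degree_condition (hk : 3 ≤ k) (hn : 0 < n) (hR : 0 ≤ R) (hρ : 24 ≤ ρ)
    (hL : 3 * k * K * L ≤ ρ) (hpK : p ≤ K * R ^ (k - 1) * L / (n : ℝ) ^ (k - 1)) {M : ℕ}
    (hM : R ^ (k - 1) / ρ ≤ M) {σ : ℕ} (hσ0 : 0 < σ) (hσ : σ < ⌈(n : ℝ) / ρ ^ 2⌉₊) :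
    3 * k * (σ : ℝ) ^ (k - 1) * p ≤ M * (σ / n) ∧ 24 * ((σ : ℝ) / n) ^ 2 ≤ 1 := by
  have hn' : (0 : ℝ) < n := by exact_mod_cast hn
  have hσ' : (0 : ℝ) < σ := by exact_mod_cast hσ0
  have hρ0 : 0 < ρ := by linarith
  obtain ⟨x, hx⟩ : ∃ x : ℝ, x = (σ : ℝ) / n := ⟨_, rfl⟩
  have hx0 : 0 < x := hx ▸ by positivity
  have hxρ : x ≤ 1 / ρ ^ 2 := by
    have := (Nat.lt_ceil.1 hσ).le
    rw [le_div_iff₀ (by positivity)] at this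
    rw [hx, div_le_div_iff₀ hn' (by positivity)]
    linarith
  have hρ2 : 1 / ρ ^ 2 ≤ 1 / 24 := by
    apply one_div_le_one_div_of_le (by norm_num); nlinarith
  have hx1 : x ≤ 1 / 24 := hxρ.trans hρ2
  have hM0 : (0 : ℝ) ≤ M := Nat.cast_nonneg _
  rw [← hx]
  refine ⟨?_, by nlinarith⟩
  have hxk : x ^ (k - 1) ≤ x * (1 / ρ ^ 2) := by
    obtain ⟨j, rfl⟩ : ∃ j, k = j + 3 := ⟨k - 3, by omega⟩
    have : x ^ j ≤ 1 := pow_le_one₀ hx0.le (by linarith)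
    calc x ^ (j + 3 - 1) = x * (x ^ j * x) := by
          rw [show j + 3 - 1 = j + 2 by omega]; ring
      _ ≤ x * (1 * (1 / ρ ^ 2)) := by gcongr
      _ = _ := by ring
  calc 3 * k * (σ : ℝ) ^ (k - 1) * p
      ≤ 3 * k * (σ : ℝ) ^ (k - 1) * (K * R ^ (k - 1) * L / (n : ℝ) ^ (k - 1)) := by gcongr
    _ = (3 * k * K * L) * (R ^ (k - 1) * x ^ (k - 1)) := by rw [hx, div_pow]; ring
    _ ≤ ρ * (R ^ (k - 1) * (x * (1 / ρ ^ 2))) := by gcongr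
    _ = R ^ (k - 1) / ρ * x := by field_simp
    _ ≤ M * x := by gcongr

lemma density_condition (hk : 3 ≤ k) (hn : 0 < n) {c : ℝ} (hc : 0 < c) (hR : 12 ≤ R) (hρ : 1 ≤ ρ)
    (hK : 0 ≤ K) (hL0 : 0 ≤ L) (hp0 : 0 ≤ p)
    (hρR : ρ ^ 4 ≤ R) (hL : 48 * k * K / c * L ≤ ρ)
    (hpK : p ≤ K * R ^ (k - 1) * L / (n : ℝ) ^ (k - 1)) {M y : ℕ}
    (hM : R ^ (k - 1) / ρ ≤ M) (hy : c * R ≤ y) (hyk : 4 * k + 4 ≤ y) {σ : ℕ} (hσ0 : 0 < σ)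
    (hσ : M * σ ≤ 16 * k * n) :
    (3 * σ * (n : ℝ) ^ (k - 2) * p / y) ^ y ≤ ((σ : ℝ) / n) ^ 2 / 12 := by
  have hn' : (0 : ℝ) < n := by exact_mod_cast hn
  have hσ' : (0 : ℝ) < σ := by exact_mod_cast hσ0
  have hR0 : 0 < R := by linarith
  have hk' : (3 : ℝ) ≤ k := by exact_mod_cast hk
  have hy0 : (0 : ℝ) < y := lt_of_lt_of_le (by positivity) hy
  obtain ⟨x, hx⟩ : ∃ x : ℝ, x = (σ : ℝ) / n := ⟨_, rfl⟩
  obtain ⟨w, hw⟩ : ∃ w : ℝ, w = 3 * σ * (n : ℝ) ^ (k - 2) * p / y := ⟨_, rfl⟩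
  have hx0 : 0 < x := hx ▸ by positivity
  have hw0 : 0 ≤ w := hw ▸ by positivity
  rw [← hx, ← hw]
  have hw1 : w ≤ 3 * K / c * L * (R ^ (k - 2) * x) := by
    obtain ⟨j, rfl⟩ : ∃ j, k = j + 2 := ⟨k - 2, by omega⟩
    simp only [show j + 2 - 1 = j + 1 by omega, show j + 2 - 2 = j by omega] at *
    calc w ≤ 3 * σ * (n : ℝ) ^ j * (K * R ^ (j + 1) * L / (n : ℝ) ^ (j + 1)) / (c * R) := by
          rw [hw]; gcongr
      _ = _ := by rw [hx]; field_simp; ring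
  have hxR : x * R ^ (k - 1) ≤ 16 * k * ρ := by
    have h1 : (M : ℝ) * σ ≤ 16 * k * n := by exact_mod_cast hσ
    have h2 : (M : ℝ) * x ≤ 16 * k := by
      rw [hx, ← mul_div_assoc, div_le_iff₀ hn']; exact h1
    have h3 : R ^ (k - 1) / ρ * x ≤ 16 * k := le_trans (by gcongr) h2
    rw [div_mul_eq_mul_div, div_le_iff₀ (by linarith)] at h3
    linarith
  have hwR : w * R ≤ ρ ^ 2 := by
    calc w * R ≤ 3 * K / c * L * (R ^ (k - 2) * x) * R := by gcongr
      _ = 3 * K / c * L * (x * R ^ (k - 1)) := by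
          rw [show k - 1 = (k - 2) + 1 by omega, pow_succ]; ring
      _ ≤ 3 * K / c * L * (16 * k * ρ) := by gcongr
      _ = (48 * k * K / c * L) * ρ := by ring
      _ ≤ ρ * ρ := by gcongr
      _ = _ := by ring
  have hw2 : w ^ 2 ≤ 1 / R := by
    rw [le_div_iff₀ hR0]
    have : (w * R) ^ 2 ≤ R * 1 := by
      calc (w * R) ^ 2 ≤ (ρ ^ 2) ^ 2 := by gcongr
        _ = ρ ^ 4 := by ring
        _ ≤ R * 1 := by linarith
    have h5 : R * (w ^ 2 * R) ≤ R * 1 := by linarith [show R * (w ^ 2 * R) = (w * R) ^ 2 by ring]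
    exact le_of_mul_le_mul_left h5 hR0
  have hw1' : w ≤ 1 := by
    have : w ^ 2 ≤ 1 := hw2.trans (by rw [div_le_one hR0]; linarith)
    nlinarith
  have hwx : w ≤ x * R ^ k := by
    have h6 : 3 * K / c * L ≤ R ^ 2 := by
      have h7 : 3 * K / c * L ≤ 48 * k * K / c * L := by
        have : 3 * K ≤ 48 * k * K := by nlinarith
        gcongr
      have h8 : ρ ≤ R := le_trans (le_self_pow₀ hρ (by norm_num)) hρR
      nlinarith
    calc w ≤ 3 * K / c * L * (R ^ (k - 2) * x) := hw1
      _ ≤ R ^ 2 * (R ^ (k - 2) * x) := by gcongr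
      _ = x * R ^ k := by
          conv_rhs => rw [show k = 2 + (k - 2) by omega, pow_add]
          ring
  calc w ^ y ≤ w ^ (4 * k + 4) := pow_le_pow_of_le_one hw0 hw1' hyk
    _ = w ^ 2 * (w ^ 2) ^ (2 * k + 1) := by ring
    _ ≤ (x * R ^ k) ^ 2 * (1 / R) ^ (2 * k + 1) := by gcongr
    _ = x ^ 2 / R := by
        rw [one_div, inv_pow, mul_pow, ← pow_mul, mul_comm k 2, pow_succ]
        field_simp
        ring
    _ ≤ x ^ 2 / 12 := by gcongr

lemma exp_neg_div_le_one_sub_pow (hp1 : p < 1) (m : ℕ) :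
    Real.exp (-(p * m / (1 - p))) ≤ (1 - p) ^ m := by
  have h : 0 < 1 - p := by linarith
  have h1 : Real.exp (-(p / (1 - p))) ≤ 1 - p := by
    rw [Real.exp_neg, inv_le_comm₀ (Real.exp_pos _) h]
    have := Real.add_one_le_exp (p / (1 - p))
    have h2 : p / (1 - p) + 1 = (1 - p)⁻¹ := by field_simp; ring
    linarith
  calc _ = Real.exp (-(p / (1 - p))) ^ m := by rw [← Real.exp_nat_mul]; congr 1; ring
    _ ≤ _ := by gcongr

/-- The failure probability bound for greedily removing independent sets. -/
lemma independent_failure_le {δ : ℝ} {s u r : ℕ} (hn : 0 < n) (hr : 0 < r)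
    (hp1 : p < 1) (hs1 : (n : ℝ) ≤ s * r) (hs2 : (s : ℝ) * r ≤ 3 * n)
    (hρ : 24 ≤ ρ) (hρδ : ρ ^ 8 = (r : ℝ) ^ δ) (hρr : ρ ^ 4 ≤ r)
    (hL : 72 * Real.log r ≤ ρ) (hL1 : 1 ≤ Real.log r) (hu1 : (n : ℝ) / ρ ^ 2 ≤ u) (hun : u ≤ n)
    (hps : p * (s.choose (k - 1)) / (1 - p) ≤ (1 - δ) * Real.log r) :
    (((u / (2 * s) : ℕ) : ℝ) + 2) ^ n *
      Real.exp (-((1 - p) ^ (s.choose (k - 1)) *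
        ((u / (2 * s) : ℕ) * ((u - u / (2 * s) * s : ℕ) : ℝ)))) ≤ Real.exp (-n) := by
  have hn' : (0 : ℝ) < n := by exact_mod_cast hn
  have hr' : (0 : ℝ) < r := by exact_mod_cast hr
  have hs0 : (0 : ℝ) < s := by
    by_contra! h
    nlinarith
  have hρ0 : 0 < ρ := by linarith
  have hρ2 : 24 ≤ ρ ^ 2 := by nlinarith
  obtain ⟨J, hJ⟩ : ∃ J, J = u / (2 * s) := ⟨_, rfl⟩
  rw [← hJ]
  have hJ1 : J * (2 * s) ≤ u := hJ ▸ Nat.div_mul_le_self _ _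
  have hJ2 : u < (J + 1) * (2 * s) := by
    rw [hJ]
    have hs0' : 0 < 2 * s := by exact_mod_cast (by positivity : (0 : ℝ) < 2 * s)
    have h1 := Nat.lt_div_mul_add (a := u) hs0'
    linarith
  have hsub : ((u - J * s : ℕ) : ℝ) = u - J * s := by
    rw [Nat.cast_sub (by nlinarith)]; push_cast; ring
  rw [hsub]
  have hJ1' : (J : ℝ) * (2 * s) ≤ u := by exact_mod_cast hJ1
  have hJ2' : (u : ℝ) < (J + 1) * (2 * s) := by exact_mod_cast hJ2
  have hun' : (u : ℝ) ≤ n := by exact_mod_cast hun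
  rw [div_le_iff₀ (by positivity)] at hu1
  have hJlow : (r : ℝ) ≤ 12 * ρ ^ 2 * J := by
    have h1 : (n : ℝ) * r ≤ 6 * ((J + 1) * ρ ^ 2) * n := by
      calc (n : ℝ) * r ≤ (u * ρ ^ 2) * r := by gcongr
        _ ≤ ((J + 1) * (2 * s) * ρ ^ 2) * r := by gcongr
        _ = 2 * ((J + 1) * ρ ^ 2) * (s * r) := by ring
        _ ≤ 2 * ((J + 1) * ρ ^ 2) * (3 * n) := by gcongr
        _ = _ := by ring
    have h2 : (r : ℝ) ≤ 6 * ((J + 1) * ρ ^ 2) := le_of_mul_le_mul_right (by linarith) hn'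
    have h3 : 12 * ρ ^ 2 ≤ r := by nlinarith
    nlinarith
  have hJup : (J : ℝ) + 2 ≤ (r : ℝ) ^ 2 := by
    have h1 : (J : ℝ) * n ≤ r * n := by
      calc (J : ℝ) * n ≤ J * (s * r) := by gcongr
        _ = (J * s) * r := by ring
        _ ≤ n * r := by gcongr; nlinarith [Nat.cast_nonneg (α := ℝ) u]
        _ = _ := by ring
    have h2 : (J : ℝ) ≤ r := le_of_mul_le_mul_right h1 hn'
    have h3 : (2 : ℝ) ≤ r := by nlinarith
    nlinarith
  have hq : (r : ℝ) ^ (-(1 - δ)) ≤ (1 - p) ^ (s.choose (k - 1)) := by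
    refine le_trans ?_ (exp_neg_div_le_one_sub_pow hp1 _)
    rw [Real.rpow_def_of_pos hr']
    gcongr
    linarith
  have hprod : (n : ℝ) * r ≤ 24 * ρ ^ 4 * (J * (u - J * s)) := by
    have h1 : (n : ℝ) ≤ 2 * ρ ^ 2 * (u - J * s) := by nlinarith [sq_nonneg ρ]
    have h2 := hn'.le.trans h1
    calc (n : ℝ) * r ≤ (2 * ρ ^ 2 * (u - J * s)) * (12 * ρ ^ 2 * J) := by gcongr
      _ = _ := by ring
  have hexp : (n : ℝ) * (2 * Real.log r + 1) ≤
      (1 - p) ^ (s.choose (k - 1)) * (J * (u - J * s)) := by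
    have h1 : (n : ℝ) * ρ ^ 8 ≤ 24 * ρ ^ 4 *
        ((1 - p) ^ (s.choose (k - 1)) * (J * (u - J * s))) := by
      calc (n : ℝ) * ρ ^ 8 = (r : ℝ) ^ (-(1 - δ)) * (n * r) := by
            rw [hρδ, show (δ : ℝ) = -(1 - δ) + 1 by ring, Real.rpow_add_one hr'.ne']
            ring_nf
        _ ≤ (1 - p) ^ (s.choose (k - 1)) * (24 * ρ ^ 4 * (J * (u - J * s))) := by gcongr
        _ = _ := by ring
    have h2 : 24 * (2 * Real.log r + 1) ≤ ρ ^ 4 := by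
      have : ρ ≤ ρ ^ 4 := le_self_pow₀ (by linarith) (by norm_num)
      linarith
    have h3 : 24 * ρ ^ 4 * (n * (2 * Real.log r + 1)) ≤ 24 * ρ ^ 4 *
        ((1 - p) ^ (s.choose (k - 1)) * (J * (u - J * s))) := by
      refine le_trans ?_ h1
      calc 24 * ρ ^ 4 * (n * (2 * Real.log r + 1))
          = n * ρ ^ 4 * (24 * (2 * Real.log r + 1)) := by ring
        _ ≤ n * ρ ^ 4 * ρ ^ 4 := by gcongr
        _ = _ := by ring
    exact le_of_mul_le_mul_left h3 (by positivity)
  calc _ ≤ ((r : ℝ) ^ 2) ^ n * Real.exp (-(n * (2 * Real.log r + 1))) := by gcongr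
    _ = Real.exp (n * (2 * Real.log r)) * Real.exp (-(n * (2 * Real.log r + 1))) := by
        congr 1
        rw [Real.exp_nat_mul, two_mul, Real.exp_add, Real.exp_log hr', sq]
    _ = Real.exp (-n) := by rw [← Real.exp_add]; congr 1; ring

lemma div_choose_le (hn : k < n) :
    (n : ℝ) / n.choose k ≤ k.factorial * (n / (n - k) ^ k) := by
  have hn' : (k : ℝ) < n := by exact_mod_cast hn
  have h1 : ((n : ℝ) - k) ^ k / k.factorial ≤ n.choose k := by
    refine le_trans ?_ (Nat.pow_le_choose k n)
    have : (n : ℝ) - k ≤ ((n + 1 - k : ℕ) : ℝ) := by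
      rw [Nat.cast_sub (by omega)]; push_cast; linarith
    have h0 : 0 ≤ (n : ℝ) - k := by linarith
    gcongr
  have h2 : 0 < ((n : ℝ) - k) ^ k / k.factorial := by
    have : 0 < (n : ℝ) - k := by linarith
    positivity
  calc (n : ℝ) / n.choose k ≤ n / (((n : ℝ) - k) ^ k / k.factorial) := by gcongr
    _ = _ := by rw [div_div_eq_mul_div]; ring

lemma div_choose_le_of_two_mul_le (hk : 0 < k) (hn : 2 * k ≤ n) :
    (n : ℝ) / n.choose k ≤ k.factorial * 2 ^ k / (n : ℝ) ^ (k - 1) := by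
  have hn0 : (0 : ℝ) < n := by exact_mod_cast (by omega : 0 < n)
  have hn' : 2 * (k : ℝ) ≤ n := by exact_mod_cast hn
  refine (div_choose_le (by omega)).trans ?_
  calc (k.factorial : ℝ) * (n / (n - k) ^ k) ≤ k.factorial * (n / (n / 2) ^ k) := by
        gcongr; linarith
    _ = _ := by
        obtain ⟨j, rfl⟩ : ∃ j, k = j + 1 := ⟨k - 1, by omega⟩
        rw [div_pow, Nat.add_sub_cancel, pow_succ (n : ℝ) j]
        field_simp

lemma edgeProb_mul_choose_le {ε : ℝ} (hε : ε ≤ 1) (hk : 2 ≤ k) (hn : k < n) (r s : ℕ) :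
    (1 - ε) * ((r : ℝ) ^ (k - 1) * Real.log r / k) * (n / n.choose k) * s.choose (k - 1) ≤
      (1 - ε) * Real.log r * ((s * r / n) ^ (k - 1) * (n / (n - k)) ^ k) := by
  have hn' : (k : ℝ) < n := by exact_mod_cast hn
  have hn0 : (0 : ℝ) < n := by exact_mod_cast (by omega : 0 < n)
  have hnk : 0 < (n : ℝ) - k := by linarith
  have h1ε : 0 ≤ 1 - ε := by linarith
  obtain ⟨j, rfl⟩ : ∃ j, k = j + 1 := ⟨k - 1, by omega⟩
  have h1 := div_choose_le (k := j + 1) hn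
  have h2 : (s.choose j : ℝ) ≤ (s : ℝ) ^ j / j.factorial := Nat.choose_le_pow_div _ _
  have hj : ((j + 1 : ℕ) : ℝ) ≠ 0 := by positivity
  rw [Nat.add_sub_cancel]
  calc _ ≤ (1 - ε) * ((r : ℝ) ^ j * Real.log r / (j + 1 : ℕ)) *
        ((j + 1).factorial * (n / (n - (j + 1 : ℕ)) ^ (j + 1))) *
          ((s : ℝ) ^ j / j.factorial) := by gcongr
    _ = _ := by
        rw [Nat.factorial_succ, Nat.cast_mul, div_pow, div_pow, mul_pow, pow_succ (n : ℝ) j]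
        field_simp

set_option maxHeartbeats 1000000 in
/-- The quantitative content of the theorem, for fixed `n` and `r`. -/
lemma one_sub_le_of_bounds {ε η c : ℝ} (hε0 : 0 < ε) (hε1 : ε < 1) (hk : 3 ≤ k) {r : ℕ}
    (hη : η = ε / (4 * k)) (hc : c = η / (16 * k ^ 2)) (hK : K = k.factorial * 2 ^ k)
    (hr3 : 3 ≤ r)
    (hr : (72 + 48 * k * K / c + 4 / c ^ (k - 1) + (4 * k + 4) / c) * Real.log r ≤
      (r : ℝ) ^ (ε / 16))
    (hn : 2 * k ≤ n) (hrn : r ≤ n)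
    (hp : p = (1 - ε) * ((r : ℝ) ^ (k - 1) * Real.log r / k) * (n / n.choose k)) (hp1 : p < 1)
    (hlim : (1 / (1 - η) + r / n) ^ (k - 1) * ((n : ℝ) / (n - k)) ^ k / (1 - p) ≤ 1 + ε / 2) :
    1 - (Real.exp (-n) + 4 / n) ≤ hyperProb n k p (RChoosable r) := by
  have hk' : (3 : ℝ) ≤ k := by exact_mod_cast hk
  have hn0 : 0 < n := by omega
  have hn' : (0 : ℝ) < n := by exact_mod_cast hn0
  have hr3' : (3 : ℝ) ≤ r := by exact_mod_cast hr3
  have hr0 : (0 : ℝ) < r := by linarith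
  have hrn' : (r : ℝ) ≤ n := by exact_mod_cast hrn
  have hK0 : 0 < K := hK ▸ by positivity
  have hη0 : 0 < η := hη ▸ by positivity
  have hη1 : η ≤ 1 / 12 := by
    rw [hη, div_le_div_iff₀ (by positivity) (by norm_num)]; linarith
  have hc0 : 0 < c := hc ▸ by positivity
  have hc1 : c ≤ 1 := by
    rw [hc, div_le_one (by positivity)]; nlinarith
  have h1ε : 0 < 1 - ε := by linarith
  set L := Real.log r with hL
  have hL1 : 1 ≤ L := by
    rw [hL, Real.le_log_iff_exp_le hr0]
    linarith [Real.exp_one_lt_d9]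
  set ρ : ℝ := (r : ℝ) ^ (ε / 16) with hρ
  have hρ16 : ρ ^ 16 ≤ r := by
    rw [hρ, ← Real.rpow_mul_natCast hr0.le]
    calc (r : ℝ) ^ (ε / 16 * (16 : ℕ)) ≤ (r : ℝ) ^ (1 : ℝ) :=
          Real.rpow_le_rpow_of_exponent_le (by linarith) (by push_cast; linarith)
      _ = r := Real.rpow_one _
  have hρ8 : ρ ^ 8 = (r : ℝ) ^ (ε / 2) := by
    rw [hρ, ← Real.rpow_mul_natCast hr0.le]
    congr 1; push_cast; ring
  have t1 : 0 ≤ 48 * k * K / c := by positivity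
  have t2 : 0 ≤ 4 / c ^ (k - 1) := by positivity
  have t3 : 0 ≤ (4 * k + 4) / c := by positivity
  have hr1 : 72 * L ≤ ρ := le_trans (by gcongr; linarith) hr
  have hr2 : 48 * k * K / c * L ≤ ρ := le_trans (by gcongr; linarith) hr
  have hr4 : 4 / c ^ (k - 1) ≤ ρ :=
    le_trans (le_mul_of_one_le_right t2 hL1) (le_trans (by gcongr; linarith) hr)
  have hr5 : (4 * k + 4) / c ≤ ρ :=
    le_trans (le_mul_of_one_le_right t3 hL1) (le_trans (by gcongr; linarith) hr)
  have hρ24 : 24 ≤ ρ := by linarith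
  have hρ0 : 0 < ρ := by linarith
  have hρ4 : ρ ^ 4 ≤ r := (pow_le_pow_right₀ (by linarith) (by norm_num)).trans hρ16
  have hρ1 : ρ ≤ r := (le_self_pow₀ (by linarith) (by norm_num)).trans hρ16
  have hp0 : 0 ≤ p := hp ▸ by positivity
  have hpK : p ≤ K * (r : ℝ) ^ (k - 1) * L / (n : ℝ) ^ (k - 1) := by
    have h1 := div_choose_le_of_two_mul_le (by omega) hn
    calc p ≤ 1 * ((r : ℝ) ^ (k - 1) * L / 1) *
          (k.factorial * 2 ^ k / (n : ℝ) ^ (k - 1)) := by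
          rw [hp]; gcongr <;> linarith
      _ = _ := by rw [hK]; ring
  obtain ⟨y, hy⟩ : ∃ y, y = ⌊2 * c * r⌋₊ := ⟨_, rfl⟩
  obtain ⟨s, hs⟩ : ∃ s, s = ⌈(n : ℝ) / ((1 - η) * r)⌉₊ := ⟨_, rfl⟩
  obtain ⟨M, hM⟩ : ∃ M, M = ⌈(r : ℝ) ^ (k - 1) / ρ⌉₊ := ⟨_, rfl⟩
  obtain ⟨u, hu⟩ : ∃ u, u = ⌈(n : ℝ) / ρ ^ 2⌉₊ := ⟨_, rfl⟩
  have hcr : 4 * k + 4 ≤ c * r := by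
    rw [div_le_iff₀ hc0] at hr5
    exact hr5.trans (by rw [mul_comm]; gcongr)
  have hy1 : c * r ≤ y := by
    have := Nat.lt_floor_add_one (2 * c * r)
    rw [← hy] at this
    linarith
  have hyk : 4 * k + 4 ≤ y := by exact_mod_cast hcr.trans hy1
  have hy2 : 8 * (k ^ 2 * y) ≤ η * (r : ℝ) := by
    have h1 : (y : ℝ) ≤ 2 * c * r := hy ▸ Nat.floor_le (by positivity)
    calc 8 * (k ^ 2 * y) ≤ 8 * (k ^ 2 * (2 * c * (r : ℝ))) := by gcongr
      _ = _ := by rw [hc]; field_simp; norm_num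
  have h1η : 0 < 1 - η := by linarith
  have hy3 : 8 * (k ^ 2 * y) ≤ r := by
    have : ((8 * (k ^ 2 * y) : ℕ) : ℝ) ≤ r := by
      push_cast
      exact hy2.trans (mul_le_of_le_one_left hr0.le (by linarith))
    exact_mod_cast this
  have hs1 : (n : ℝ) ≤ s * ((1 - η) * r) := by
    rw [← div_le_iff₀ (by positivity)]
    exact hs ▸ Nat.le_ceil _
  have hs2 : (s : ℝ) * r / n ≤ 1 / (1 - η) + r / n := by
    have h1 : (s : ℝ) < n / ((1 - η) * r) + 1 := hs ▸ Nat.ceil_lt_add_one (by positivity)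
    calc (s : ℝ) * r / n ≤ (n / ((1 - η) * r) + 1) * r / n := by gcongr
      _ = _ := by field_simp
  have hs3 : (s : ℝ) * r ≤ 3 * n := by
    rw [← div_le_iff₀ hn']
    refine hs2.trans ?_
    have h1 : 1 / (1 - η) ≤ 2 := by rw [div_le_iff₀ h1η]; linarith
    have h2 : (r : ℝ) / n ≤ 1 := by rw [div_le_one hn']; exact hrn'
    linarith
  have hs0 : 0 < s := hs ▸ Nat.ceil_pos.2 (by positivity)
  have hM1 : (r : ℝ) ^ (k - 1) / ρ ≤ M := hM ▸ Nat.le_ceil _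
  have hM0 : 0 < M := hM ▸ Nat.ceil_pos.2 (by positivity)
  have hM2 : 2 * M ≤ (k ^ 2 * y) ^ (k - 1) := by
    have h1 : (M : ℝ) < (r : ℝ) ^ (k - 1) / ρ + 1 :=
      hM ▸ Nat.ceil_lt_add_one (by positivity)
    have h2 : 4 ≤ ρ * c ^ (k - 1) := by rwa [div_le_iff₀ (by positivity)] at hr4
    have h3 : (r : ℝ) ≤ (r : ℝ) ^ (k - 1) := le_self_pow₀ (by linarith) (by omega)
    have h4 : (r : ℝ) ^ (k - 1) / ρ ≤ (c * r) ^ (k - 1) / 4 := by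
      rw [div_le_div_iff₀ hρ0 (by norm_num), mul_pow]
      linarith [mul_le_mul_of_nonneg_left h2 (pow_pos hr0 (k - 1)).le]
    have h5 : 1 ≤ (c * r) ^ (k - 1) / 4 := by
      rw [mul_pow]
      linarith [mul_le_mul_of_nonneg_left (hρ1.trans h3) (pow_pos hc0 (k - 1)).le]
    have h6 : (c * r) ^ (k - 1) ≤ ((k : ℝ) ^ 2 * y) ^ (k - 1) := by
      have h8 : c * r ≤ 1 * y := by linarith
      have h9 : (1 : ℝ) ≤ k ^ 2 := one_le_pow₀ (by linarith)
      refine pow_le_pow_left₀ (by positivity) (h8.trans ?_) _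
      gcongr
    have h7 : ((2 * M : ℕ) : ℝ) ≤ (((k ^ 2 * y) ^ (k - 1) : ℕ) : ℝ) := by
      push_cast; linarith
    exact_mod_cast h7
  have hun : u ≤ n := by
    rw [hu, Nat.ceil_le]
    exact div_le_self hn'.le (one_le_pow₀ (by linarith))
  have hps : p * (s.choose (k - 1)) / (1 - p) ≤ (1 - ε / 2) * L := by
    have h1p : 0 < 1 - p := by linarith
    have hnk : (0 : ℝ) < n - k := by
      have : 2 * (k : ℝ) ≤ n := by exact_mod_cast hn
      linarith
    have h1 := edgeProb_mul_choose_le hε1.le (by omega : 2 ≤ k) (by omega : k < n) r s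
    rw [← hp] at h1
    calc p * (s.choose (k - 1)) / (1 - p)
        ≤ (1 - ε) * L * ((1 / (1 - η) + r / n) ^ (k - 1) * ((n : ℝ) / (n - k)) ^ k) /
          (1 - p) := by
          refine div_le_div_of_nonneg_right (h1.trans ?_) h1p.le
          gcongr
      _ = (1 - ε) * L *
          ((1 / (1 - η) + r / n) ^ (k - 1) * ((n : ℝ) / (n - k)) ^ k / (1 - p)) := by ring
      _ ≤ (1 - ε) * L * (1 + ε / 2) := by gcongr
      _ = (1 - ε / 2 - ε ^ 2 / 2) * L := by ring
      _ ≤ (1 - ε / 2) * L := by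
          refine mul_le_mul_of_nonneg_right (sub_le_self _ (by positivity)) (by linarith)
  have hfail := independent_failure_le hn0 (by omega : 0 < r) hp1
    (hs1.trans (by gcongr; exact mul_le_of_le_one_left hr0.le (by linarith))) hs3 hρ24 hρ8
    hρ4 hr1 hL1 (hu ▸ Nat.le_ceil _) hun hps
  have hmain := one_sub_le_hyperProb_rChoosable (a := r - 8 * (k ^ 2 * y)) (u := u)
    (J := u / (2 * s)) hn0 (by omega : 2 ≤ k) hp0 hp1.le hs0 (by omega : 0 < y) hM0
    (Nat.sub_add_cancel hy3).le (by
      have : (n : ℝ) ≤ ((s * (r - 8 * (k ^ 2 * y)) : ℕ) : ℝ) := by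
        rw [Nat.cast_mul, Nat.cast_sub hy3]
        refine hs1.trans ?_
        gcongr
        push_cast
        linarith
      exact_mod_cast this) hM2
    (fun σ hσ0 hσ => degree_condition hk hn0 hr0.le hρ24 (le_trans (by
      gcongr
      rw [le_div_iff₀ hc0]
      calc 3 * k * K * c ≤ 48 * k * K * 1 := by gcongr; norm_num
        _ = _ := mul_one _) hr2) hpK hM1 hσ0 (hu ▸ hσ))
    (fun σ hσ0 hσ => density_condition hk hn0 hc0 (by linarith) (by linarith) hK0.le
      (by linarith) hp0 hρ4 hr2 hpK hM1 hy1 hyk hσ0 hσ)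
  linarith

lemma one_div_one_sub_pow_lt {ε : ℝ} (hε0 : 0 < ε) (hε1 : ε < 1) (hk : 0 < k) :
    (1 / (1 - ε / (4 * k))) ^ (k - 1) < 1 + ε / 2 := by
  have hk' : (1 : ℝ) ≤ k := by exact_mod_cast hk
  have h1 : ε / (4 * k) ≤ 1 := by
    rw [div_le_one (by positivity)]; linarith
  have h2 : 1 - ε / 4 ≤ (1 - ε / (4 * k)) ^ (k - 1) := by
    have h3 := one_add_mul_le_pow (a := -(ε / (4 * k))) (by linarith) (k - 1)
    rw [← sub_eq_add_neg] at h3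
    refine le_trans ?_ h3
    rw [Nat.cast_sub hk]
    have h4 : ((k : ℝ) - (1 : ℕ)) * (ε / (4 * k)) ≤ ε / 4 := by
      calc ((k : ℝ) - (1 : ℕ)) * (ε / (4 * k)) ≤ k * (ε / (4 * k)) := by
            gcongr; push_cast; linarith
        _ = ε / 4 := by field_simp
    linarith
  rw [div_pow, one_pow, div_lt_iff₀ (by linarith)]
  nlinarith

lemma eventually_le_rpow (C : ℝ) {δ : ℝ} (hδ : 0 < δ) :
    ∀ᶠ r : ℕ in atTop, C * Real.log r ≤ (r : ℝ) ^ δ := by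
  have h := ((isLittleO_log_rpow_atTop hδ).const_mul_left C).comp_tendsto
    tendsto_natCast_atTop_atTop
  filter_upwards [h.bound one_pos] with r hr
  have h1 : (0 : ℝ) ≤ (r : ℝ) ^ δ := by positivity
  simp only [Function.comp_apply, Real.norm_eq_abs, one_mul, abs_of_nonneg h1] at hr
  exact (le_abs_self _).trans hr

lemma tendsto_div_of_isLittleO {r : ℕ → ℕ} (hr3 : ∀ n, 3 ≤ r n)
    (ho : (fun n => (r n : ℝ) ^ (k - 1) * Real.log (r n)) =o[atTop] fun n => (n : ℝ) ^ (k - 1)) :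
    Tendsto (fun n => (r n : ℝ) / n) atTop (nhds 0) := by
  have h1 := ho.tendsto_div_nhds_zero
  have h2 : Tendsto (fun n => ((r n : ℝ) / n) ^ (k - 1)) atTop (nhds 0) := by
    refine squeeze_zero (fun n => by positivity) (fun n => ?_) h1
    have h3 : (3 : ℝ) ≤ r n := by exact_mod_cast hr3 n
    have h4 : 1 ≤ Real.log (r n) := by
      rw [Real.le_log_iff_exp_le (by linarith)]
      linarith [Real.exp_one_lt_d9]
    rw [div_pow]
    gcongr
    exact le_mul_of_one_le_right (by positivity) h4
  rw [tendsto_order] at h2 ⊢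
  refine ⟨fun a ha => Eventually.of_forall fun n => ha.trans_le (by positivity), fun a ha => ?_⟩
  filter_upwards [h2.2 (a ^ (k - 1)) (by positivity)] with n hn
  exact lt_of_pow_lt_pow_left₀ _ ha.le hn

lemma tendsto_edgeProb {r : ℕ → ℕ}
    (ho : (fun n => (r n : ℝ) ^ (k - 1) * Real.log (r n)) =o[atTop] fun n => (n : ℝ) ^ (k - 1))
    (hk : 2 ≤ k) {ε : ℝ} (hε : ε ≤ 1) :
    Tendsto (fun n => (1 - ε) * ((r n : ℝ) ^ (k - 1) * Real.log (r n) / (k : ℝ)) *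
      ((n : ℝ) / (n.choose k : ℝ))) atTop (nhds 0) := by
  have h1 := (ho.tendsto_div_nhds_zero.const_mul ((1 - ε) / k * (k.factorial * 2 ^ k)))
  rw [mul_zero] at h1
  have h1ε : 0 ≤ 1 - ε := by linarith
  refine squeeze_zero' (Eventually.of_forall fun n => ?_) ?_ h1
  · have := Real.log_natCast_nonneg (r n)
    positivity
  · filter_upwards [eventually_ge_atTop (2 * k)] with n hn
    have := Real.log_natCast_nonneg (r n)
    calc _ ≤ (1 - ε) * ((r n : ℝ) ^ (k - 1) * Real.log (r n) / (k : ℝ)) *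
          (k.factorial * 2 ^ k / (n : ℝ) ^ (k - 1)) := by
          refine mul_le_mul_of_nonneg_left (div_choose_le_of_two_mul_le (by omega) hn) ?_
          positivity
      _ = _ := by ring

lemma tendsto_div_sub_const (k : ℕ) :
    Tendsto (fun n : ℕ => (n : ℝ) / (n - k)) atTop (nhds 1) := by
  have h1 : Tendsto (fun n : ℕ => 1 + (k : ℝ) / (n - k)) atTop (nhds (1 + 0)) := by
    refine tendsto_const_nhds.add (Tendsto.div_atTop tendsto_const_nhds ?_)
    exact tendsto_atTop_add_const_right _ _ tendsto_natCast_atTop_atTop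
  rw [add_zero] at h1
  refine h1.congr' ?_
  filter_upwards [eventually_gt_atTop k] with n hn
  have : (n : ℝ) - k ≠ 0 := sub_ne_zero.2 (by exact_mod_cast hn.ne')
  field_simp
  ring

lemma tendsto_error : Tendsto (fun n : ℕ => 1 - (Real.exp (-n) + 4 / (n : ℝ))) atTop (nhds 1) := by
  have h1 : Tendsto (fun n : ℕ => Real.exp (-(n : ℝ))) atTop (nhds 0) :=
    Real.tendsto_exp_neg_atTop_nhds_zero.comp tendsto_natCast_atTop_atTop
  have h2 : Tendsto (fun n : ℕ => 4 / (n : ℝ)) atTop (nhds 0) :=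
    tendsto_const_div_atTop_nhds_zero_nat 4
  simpa using (tendsto_const_nhds (x := (1 : ℝ))).sub (h1.add h2)

end Asymptotics

end HG

/-- Let `k ≥ 3` and `ε ∈ (0,1)` be fixed. There is a constant
`r₀ = r₀(k,ε)` such that for any function `r = r(n)` satisfying `r ≥ r₀` and
`r^(k−1) ln r = o(n^(k−1))`, one has `P(ch(H(n,k,p)) ≤ r) → 1` as `n → ∞`, where
`p = (1−ε) (r^(k−1) ln r / k) n / C(n,k)`. -/
theorem stmt19 (k : ℕ) (hk : 3 ≤ k) (ε : ℝ) (hε : ε ∈ Set.Ioo (0 : ℝ) 1) :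
    ∃ r₀ : ℕ, ∀ r : ℕ → ℕ,
      (∀ n, r₀ ≤ r n) →
      ((fun n => (r n : ℝ) ^ (k - 1) * Real.log (r n)) =o[atTop]
        fun n => (n : ℝ) ^ (k - 1)) →
      Tendsto (fun n => HG.hyperProb n k
          ((1 - ε) * ((r n : ℝ) ^ (k - 1) * Real.log (r n) / (k : ℝ)) *
            ((n : ℝ) / (n.choose k : ℝ)))
          (HG.RChoosable (r n))) atTop (nhds 1) := by
  obtain ⟨hε0, hε1⟩ := hε
  have hk0 : (0 : ℝ) < k := by exact_mod_cast (by omega : 0 < k)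
  obtain ⟨r₀, hr₀⟩ := Filter.eventually_atTop.1
    (HG.eventually_le_rpow (72 + 48 * k * (k.factorial * 2 ^ k) / (ε / (4 * k) / (16 * k ^ 2)) +
      4 / (ε / (4 * k) / (16 * k ^ 2)) ^ (k - 1) +
      (4 * k + 4) / (ε / (4 * k) / (16 * k ^ 2))) (by positivity : 0 < ε / 16))
  refine ⟨max 3 r₀, fun r hr ho => ?_⟩
  have hr3 : ∀ n, 3 ≤ r n := fun n => (le_max_left _ _).trans (hr n)
  have hdiv := HG.tendsto_div_of_isLittleO hr3 ho
  have hp := HG.tendsto_edgeProb ho (by omega) hε1.le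
  have hη : ε / (4 * k) < 1 := by
    rw [div_lt_one (by positivity)]
    have : (3 : ℝ) ≤ k := by exact_mod_cast hk
    linarith
  have hlim := ((((tendsto_const_nhds (x := 1 / (1 - ε / (4 * k)))).add hdiv).pow (k - 1)).mul
    ((HG.tendsto_div_sub_const k).pow k)).div
      ((tendsto_const_nhds (x := (1 : ℝ))).sub hp) (by norm_num)
  rw [add_zero, one_pow, mul_one, sub_zero, div_one] at hlim
  have hp1 := hp.eventually_lt_const one_pos
  refine tendsto_of_tendsto_of_tendsto_of_le_of_le' HG.tendsto_error tendsto_const_nhds ?_ ?_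
  · filter_upwards [hp1, hlim.eventually_le_const
        (HG.one_div_one_sub_pow_lt hε0 hε1 (by omega)), hdiv.eventually_lt_const one_pos,
      eventually_ge_atTop (2 * k)] with n hn1 hn2 hn3 hn4
    refine HG.one_sub_le_of_bounds hε0 hε1 hk rfl rfl rfl (hr3 n)
      (hr₀ _ ((le_max_right _ _).trans (hr n))) hn4 ?_ rfl hn1 hn2
    have hn0 : (0 : ℝ) < n := by exact_mod_cast (by omega : 0 < n)
    rw [div_lt_one hn0] at hn3
    exact_mod_cast hn3.le
  · filter_upwards [hp1] with n hn1
    refine HG.bernProb_le_one ?_ hn1.le _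
    have h1ε : 0 ≤ 1 - ε := by linarith
    have := Real.log_natCast_nonneg (r n)
    positivity
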